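/- arXiv:2511.06622 — 7 statements merged into one kernel-verified Lean document; each statement's English description precedes it below -/
import Mathlib

section
/- Let k and m be positive integers, and let T be any tree of order m with bipartition (X, Y). Then every k-connected bipartite finite simple graph G with minimum degree δ(G) ≥ 2k + 2m + max{|X|, |Y|} − 3 contains a subgraph T' isomorphic to T such that the graph G − V(T') obtained by deleting the vertices of T' is still k-connected. -/
/-- A graph `G` is `k`-connected if it has at least `k+1` vertices and removing
any set of fewer than `k` vertices leaves a connected graph. -/
def KConnected {V : Type*} (G : SimpleGraph V) (k : ℕ) : Prop :=
  k + 1 ≤ Nat.card V ∧ ∀ S : Set V, S.ncard < k → (G.induce Sᶜ).Connected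

open Finset

namespace SimpleGraph

/-- A graph is connected once no proper nonempty vertex set is free of outgoing edges. -/
theorem connected_of_forall_exists_adj {V : Type*} [Nonempty V] {G : SimpleGraph V}
    (h : ∀ A : Set V, A.Nonempty → Aᶜ.Nonempty → ∃ a ∈ A, ∃ b ∈ Aᶜ, G.Adj a b) :
    G.Connected := by
  refine ⟨fun x y => ?_⟩
  by_contra hxy
  obtain ⟨a, ha, b, hb, hab⟩ := h {z | G.Reachable x z} ⟨x, Reachable.refl x⟩ ⟨y, hxy⟩
  exact hb (Reachable.trans ha hab.reachable)

/-- Greedy embedding of a tree into a bipartite host: `C b` is the part of the host receiving the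
vertices of colour `b`, and every vertex of the other part has at least `N b` neighbours there. -/
theorem IsTree.exists_embedding_of_le_card_neighbors {V : Type*} [DecidableEq V]
    (G : SimpleGraph V) [DecidableRel G.Adj] (C : Bool → Finset V) (N : Bool → ℕ)
    (hdisj : Disjoint (C true) (C false)) (hne : ∀ b, (C b).Nonempty)
    (hN : ∀ b, ∀ x ∈ C (!b), N b ≤ #{y ∈ C b | G.Adj x y})
    (n : ℕ) {W : Type*} [Fintype W] (T : SimpleGraph W) (hcard : Fintype.card W = n)
    (hT : T.IsTree) (c : W → Bool) (hc : ∀ a b, T.Adj a b → c b = !c a)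
    (hcN : ∀ b, #{a | c a = b} ≤ N b) :
    ∃ f : W ↪ V, (∀ a b, T.Adj a b → G.Adj (f a) (f b)) ∧ ∀ a, f a ∈ C (c a) := by
  classical
  induction n generalizing W with
  | zero =>
    obtain ⟨w⟩ := hT.connected.nonempty
    exact absurd hcard (Fintype.card_pos_iff.2 ⟨w⟩).ne'
  | succ n ih =>
    rcases subsingleton_or_nontrivial W with hW | hW
    · choose x hx using hne
      exact ⟨⟨fun a => x (c a), Function.injective_of_subsingleton _⟩,
        fun a b hab => (hab.ne (Subsingleton.elim a b)).elim, fun a => hx _⟩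
    obtain ⟨v, hv⟩ := hT.exists_vert_degree_one_of_nontrivial
    have hconn := hT.connected.induce_compl_singleton_of_degree_eq_one hv
    obtain ⟨u, huv, hu⟩ := degree_eq_one_iff_existsUnique_adj.mp hv
    obtain ⟨f, hf, hfC⟩ := ih (T.induce {v}ᶜ)
      (by rw [Fintype.card_compl_set]; simp [hcard])
      ⟨hconn, hT.isAcyclic.induce _⟩ (fun a => c a)
      (fun a b hab => hc a b hab)
      (fun b => by
        refine le_trans ?_ (hcN b)
        refine Finset.card_le_card_of_injOn Subtype.val ?_ Subtype.val_injective.injOn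
        intro a ha
        simpa using ha)
    have huv' : u ∈ ({v}ᶜ : Set W) := huv.ne'
    set used : Finset V := ({a : ({v}ᶜ : Set W) | c a = c v} : Finset _).image f with hused
    have hlt : #used < #{y ∈ C (c v) | G.Adj (f ⟨u, huv'⟩) y} := by
      refine lt_of_lt_of_le ?_ (hN (c v) _ ?_)
      · refine lt_of_lt_of_le ?_ (hcN (c v))
        rw [hused, Finset.card_image_of_injective _ f.injective,
          ← Finset.card_image_of_injective _ Subtype.val_injective]
        refine Finset.card_lt_card ((Finset.ssubset_iff_of_subset ?_).2 ⟨v, by simp, by simp⟩)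
        intro a ha
        simp only [Finset.mem_image, Finset.mem_filter, Finset.mem_univ, true_and] at ha ⊢
        obtain ⟨a, h, rfl⟩ := ha
        exact h
      · have := hfC ⟨u, huv'⟩
        rwa [hc v u huv] at this
    obtain ⟨y, hy, hyu⟩ := Finset.exists_mem_notMem_of_card_lt_card hlt
    rw [Finset.mem_filter] at hy
    have hfresh : ∀ a, f a ≠ y := by
      rintro a rfl
      by_cases hac : c a = c v
      · exact hyu (Finset.mem_image_of_mem _ (by simpa using hac))
      · have h1 := hfC a
        have h2 := hy.1
        cases h3 : c a <;> cases h4 : c v <;> simp only [h3, h4] at h1 h2 hac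
        · exact hac trivial
        · exact Finset.disjoint_left.1 hdisj h2 h1
        · exact Finset.disjoint_left.1 hdisj h1 h2
        · exact hac trivial
    set g : W → V := fun a => if h : a = v then y else f ⟨a, h⟩
    have hgv : g v = y := dif_pos rfl
    have hgf : ∀ a (h : a ≠ v), g a = f ⟨a, h⟩ := fun a h => dif_neg h
    have hginj : Function.Injective g := by
      intro a b hab
      by_cases ha : a = v <;> by_cases hb : b = v
      · rw [ha, hb]
      · rw [ha, hgv, hgf b hb] at hab
        exact (hfresh _ hab.symm).elim
      · rw [hb, hgv, hgf a ha] at hab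
        exact (hfresh _ hab).elim
      · rw [hgf a ha, hgf b hb] at hab
        exact congrArg Subtype.val (f.injective hab)
    refine ⟨⟨g, hginj⟩, fun a b hab => ?_, fun a => ?_⟩ <;> simp only [Function.Embedding.coeFn_mk]
    · by_cases ha : a = v <;> by_cases hb : b = v
      · exact (hab.ne (ha.trans hb.symm)).elim
      · subst ha
        obtain rfl := hu b hab
        rw [hgv, hgf b hb]
        exact hy.2.symm
      · subst hb
        obtain rfl := hu a hab.symm
        rw [hgv, hgf a ha]
        exact hy.2
      · rw [hgf a ha, hgf b hb]
        exact hf ⟨a, ha⟩ ⟨b, hb⟩ hab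
    · by_cases ha : a = v
      · rw [ha, hgv]
        exact hy.1
      · rw [hgf a ha]
        exact hfC ⟨a, ha⟩

theorem card_eq_card_filter_add_card_filter {V : Type*} (P : Finset V) (col : V → Bool) (b : Bool) :
    #P = #{y ∈ P | col y = b} + #{y ∈ P | col y = !b} := by
  rw [← Finset.card_filter_add_card_filter_not (s := P) (fun y => col y = b)]
  congr 2
  ext y
  cases b <;> simp

/-- In a `k`-connected graph fewer than `k` vertices do not cut off a vertex set. -/
theorem exists_adj_of_kConnected {V : Type*} {G : SimpleGraph V} {k : ℕ} (hG : KConnected G k)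
    {A S : Finset V} (hS : #S < k) (hAS : Disjoint A S) {x y : V} (hx : x ∈ A) (hyA : y ∉ A) (hyS : y ∉ S) :
    ∃ u ∈ A, ∃ v, v ∉ A ∧ v ∉ S ∧ G.Adj u v := by
  have hconn := hG.2 (S : Set V) (by simpa using hS)
  have hxS : x ∉ S := Finset.disjoint_left.1 hAS hx
  obtain ⟨w⟩ := hconn.preconnected ⟨x, by simpa using hxS⟩ ⟨y, by simpa using hyS⟩
  obtain ⟨d, -, h1, h2⟩ := w.exists_boundary_dart {z | (z : V) ∈ A} hx hyA
  exact ⟨d.fst, h1, d.snd, h2, fun h => d.snd.2 (Finset.mem_coe.2 h), d.adj⟩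

section OuterBoundary

variable {V : Type*} [Fintype V] [DecidableEq V] (G : SimpleGraph V) [DecidableRel G.Adj]

/-- The vertices outside `F` with a neighbour in `F`. -/
def outerBoundary (F : Finset V) : Finset V := {v | v ∉ F ∧ ∃ u ∈ F, G.Adj u v}

variable {G}

theorem mem_outerBoundary {F : Finset V} {v : V} :
    v ∈ G.outerBoundary F ↔ v ∉ F ∧ ∃ u ∈ F, G.Adj u v := by
  simp [outerBoundary]

theorem mem_or_mem_outerBoundary {F : Finset V} {u v : V} (hu : u ∈ F) (huv : G.Adj u v) :
    v ∈ F ∨ v ∈ G.outerBoundary F := by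
  rw [mem_outerBoundary]
  by_cases hv : v ∈ F
  · exact Or.inl hv
  · exact Or.inr ⟨hv, u, hu, huv⟩

variable (G) in
/-- `F` is inclusion-minimal among the nonempty vertex sets with at most `s` outer boundary
vertices. -/
structure IsMinimalFragment (s : ℕ) (F : Finset V) : Prop where
  nonempty : F.Nonempty
  card_le : #(G.outerBoundary F) ≤ s
  lt_card : ∀ F' ⊂ F, F'.Nonempty → s < #(G.outerBoundary F')

variable (G) in
theorem exists_isMinimalFragment [Nonempty V] (s : ℕ) : ∃ F, G.IsMinimalFragment s F := by
  have huniv : (Finset.univ : Finset V) ∈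
      ({F | F.Nonempty ∧ #(G.outerBoundary F) ≤ s} : Finset (Finset V)) := by
    rw [Finset.mem_filter]
    simp [outerBoundary, Finset.univ_nonempty]
  obtain ⟨F, hF, hmin⟩ := Finset.exists_min_image _ Finset.card ⟨_, huniv⟩
  simp only [Finset.mem_filter, Finset.mem_univ, true_and] at hF hmin
  refine ⟨F, hF.1, hF.2, fun F' hF' hne => ?_⟩
  by_contra! hle
  exact (Finset.card_lt_card hF').not_ge (hmin F' ⟨hne, hle⟩)

/-- In a bipartite graph, a vertex of `F` has its neighbours in `F` or in the opposite colour class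
of the outer boundary. -/
theorem degree_le_card_add_card_outerBoundary {col : V → Bool}
    (hcol : ∀ a b, G.Adj a b → col b = !col a) {F : Finset V} {b : Bool} {x : V} (hx : x ∈ F)
    (hxb : col x = !b) :
    G.degree x ≤ #{y ∈ F | col y = b ∧ G.Adj x y} + #{y ∈ G.outerBoundary F | col y = b} := by
  rw [← G.card_neighborFinset_eq_degree]
  refine (Finset.card_le_card fun y hy => ?_).trans (Finset.card_union_le _ _)
  rw [mem_neighborFinset] at hy
  have hyb : col y = b := by rw [hcol x y hy, hxb, Bool.not_not]
  rcases mem_or_mem_outerBoundary hx hy with h | h <;> simp [h, hyb, hy]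

namespace IsMinimalFragment

variable {s M : ℕ} {F : Finset V} {col : V → Bool}

theorem add_card_le_card_neighbors (hF : G.IsMinimalFragment s F)
    (hcol : ∀ a b, G.Adj a b → col b = !col a) (hdeg : ∀ v, s + M ≤ G.degree v)
    {b : Bool} {x : V} (hx : x ∈ F) (hxb : col x = !b) :
    M + #{y ∈ G.outerBoundary F | col y = !b} ≤ #{y ∈ F | col y = b ∧ G.Adj x y} := by
  have h1 := degree_le_card_add_card_outerBoundary hcol hx hxb
  have h2 := hdeg x
  have h3 := hF.card_le
  have h4 := card_eq_card_filter_add_card_filter (G.outerBoundary F) col b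
  omega

theorem add_card_le_card_filter (hF : G.IsMinimalFragment s F)
    (hcol : ∀ a b, G.Adj a b → col b = !col a) (hM : 0 < M) (hdeg : ∀ v, s + M ≤ G.degree v)
    (b : Bool) : M + #{y ∈ G.outerBoundary F | col y = !b} ≤ #{y ∈ F | col y = b} := by
  have key : ∀ b, ∀ x ∈ F, col x = !b →
      M + #{y ∈ G.outerBoundary F | col y = !b} ≤ #{y ∈ F | col y = b} := fun b x hx hxb =>
    (hF.add_card_le_card_neighbors hcol hdeg hx hxb).trans
      (Finset.card_le_card fun y => by simp +contextual)
  obtain ⟨x, hx⟩ := hF.nonempty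
  by_cases hxb : col x = !b
  · exact key b x hx hxb
  · have h := key (!b) x hx (by simpa using hxb)
    obtain ⟨y, hy⟩ := Finset.card_pos.1 (show 0 < #{y ∈ F | col y = !b} by omega)
    rw [Finset.mem_filter] at hy
    exact key b y hy.1 hy.2

theorem card_outerBoundary_lt_card (hF : G.IsMinimalFragment s F)
    (hcol : ∀ a b, G.Adj a b → col b = !col a) (hM : 0 < M) (hdeg : ∀ v, s + M ≤ G.degree v) :
    #(G.outerBoundary F) < #F := by
  have h1 := hF.add_card_le_card_filter hcol hM hdeg true
  have h2 := hF.add_card_le_card_filter hcol hM hdeg false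
  have h3 := card_eq_card_filter_add_card_filter (G.outerBoundary F) col true
  have h4 := card_eq_card_filter_add_card_filter F col true
  simp only [Bool.not_true, Bool.not_false] at *
  omega

/-- The outer boundary of a minimal fragment can be matched into the fragment. -/
theorem exists_matching (hF : G.IsMinimalFragment s F) (hlt : #(G.outerBoundary F) < #F) :
    ∃ p : G.outerBoundary F → V, Function.Injective p ∧ ∀ a, p a ∈ F ∧ G.Adj a (p a) := by
  have hall := (Finset.all_card_le_biUnion_card_iff_exists_injective
    (fun a : G.outerBoundary F => ({y ∈ F | G.Adj a y} : Finset V))).1 fun Q => ?_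
  · simpa using hall
  by_contra! hQ
  set P := Q.biUnion fun a : G.outerBoundary F => ({y ∈ F | G.Adj a y} : Finset V) with hP
  have hPF : P ⊆ F := by
    intro y hy
    simp only [hP, Finset.mem_biUnion, Finset.mem_filter] at hy
    obtain ⟨_, _, h, _⟩ := hy
    exact h
  have hQcard : #(Q.image Subtype.val) = #Q :=
    Finset.card_image_of_injective _ Subtype.val_injective
  have hQsub : Q.image Subtype.val ⊆ G.outerBoundary F := by
    intro y hy
    obtain ⟨a, _, rfl⟩ := Finset.mem_image.1 hy
    exact a.2
  have hQle := Finset.card_le_card hQsub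
  obtain ⟨q, hq⟩ := Finset.card_pos.1 (show 0 < #Q by omega)
  obtain ⟨-, u, hu, huq⟩ := mem_outerBoundary.1 q.2
  have huP : u ∈ P := Finset.mem_biUnion.2 ⟨q, hq, by simpa [hu] using huq.symm⟩
  have hss : F \ P ⊂ F :=
    (Finset.ssubset_iff_of_subset Finset.sdiff_subset).2 ⟨u, hu, by simp [huP]⟩
  have hne : (F \ P).Nonempty := by
    rw [← Finset.card_pos, Finset.card_sdiff_of_subset hPF]
    omega
  have hsub : G.outerBoundary (F \ P) ⊆ (G.outerBoundary F \ Q.image Subtype.val) ∪ P := by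
    intro y hy
    obtain ⟨hy, z, hz, hzy⟩ := mem_outerBoundary.1 hy
    rw [Finset.mem_sdiff] at hz
    by_cases hyP : y ∈ P
    · exact Finset.mem_union_right _ hyP
    refine Finset.mem_union_left _ (Finset.mem_sdiff.2 ⟨?_, fun hyQ => ?_⟩)
    · exact mem_outerBoundary.2 ⟨fun h => hy (Finset.mem_sdiff.2 ⟨h, hyP⟩), z, hz.1, hzy⟩
    · obtain ⟨a, ha, rfl⟩ := Finset.mem_image.1 hyQ
      exact hz.2 (Finset.mem_biUnion.2 ⟨a, ha, by simpa [hz.1] using hzy.symm⟩)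
  have h1 := hF.lt_card _ hss hne
  have h2 := (Finset.card_le_card hsub).trans (Finset.card_union_le _ _)
  rw [Finset.card_sdiff_of_subset hQsub] at h2
  have h3 := hF.card_le
  omega

end IsMinimalFragment

/-- A set `R` inside a minimal fragment that avoids a matching of the outer boundary does not
belong to a small separator `R ∪ S`; the side `A` is the one with fewer boundary vertices. -/
theorem IsMinimalFragment.not_separated {k t : ℕ} {F : Finset V} (hG : KConnected G k)
    (ht : 1 ≤ t) (hdeg : ∀ v, 2 * t - 1 ≤ G.degree v)
    (hF : G.IsMinimalFragment (2 * t - 1) F)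
    {p : G.outerBoundary F → V} (hp : Function.Injective p)
    (hpF : ∀ a, p a ∈ F ∧ G.Adj a (p a))
    {R S A B : Finset V} (hRF : R ⊆ F) (hR : R.Nonempty) (hRp : ∀ a, p a ∉ R)
    (hS : #S < k) (hRS : #R + #S ≤ t) (hcover : ∀ v, v ∈ A ∨ v ∈ B ∨ v ∈ R ∨ v ∈ S)
    (hAB : Disjoint A B) (hAR : Disjoint A R) (hAS : Disjoint A S) (hBS : Disjoint B S)
    (hadj : ∀ a ∈ A, ∀ b ∈ B, ¬ G.Adj a b) (hA : A.Nonempty) (hB : B.Nonempty)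
    (hle : #(G.outerBoundary F ∩ A) ≤ #(G.outerBoundary F ∩ B)) : False := by
  have hnbr : ∀ a ∈ A, ∀ v, G.Adj a v → v ∈ A ∨ v ∈ R ∨ v ∈ S := fun a ha v hav => by
    rcases hcover v with h | h | h
    · exact Or.inl h
    · exact (hadj a ha v h hav).elim
    · exact Or.inr h
  have hsmall : #(G.outerBoundary F ∩ A) + 1 ≤ t := by
    have h1 : #(G.outerBoundary F ∩ A) + #(G.outerBoundary F ∩ B) ≤ #(G.outerBoundary F) := by
      rw [← Finset.card_union_of_disjoint
        (hAB.mono Finset.inter_subset_right Finset.inter_subset_right)]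
      exact Finset.card_le_card
        (Finset.union_subset Finset.inter_subset_left Finset.inter_subset_left)
    have h2 := hF.card_le
    omega
  have hAF : ∀ a ∈ A, a ∉ F := by
    intro a ha haF
    obtain ⟨r, hr⟩ := hR
    have hss : A ∩ F ⊂ F := (Finset.ssubset_iff_of_subset Finset.inter_subset_right).2
      ⟨r, hRF hr, fun h => Finset.disjoint_left.1 hAR (Finset.mem_inter.1 h).1 hr⟩
    have h1 := hF.lt_card _ hss ⟨a, Finset.mem_inter.2 ⟨ha, haF⟩⟩
    have hsub : G.outerBoundary (A ∩ F) ⊆ (R ∪ S) ∪ (G.outerBoundary F ∩ A) := by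
      intro v hv
      obtain ⟨hv, u, hu, huv⟩ := mem_outerBoundary.1 hv
      rw [Finset.mem_inter] at hu hv
      rcases hnbr u hu.1 v huv with h | h | h
      · have hvF : v ∉ F := fun h' => hv ⟨h, h'⟩
        simp [h, mem_outerBoundary.2 ⟨hvF, u, hu.2, huv⟩]
      · simp [h]
      · simp [h]
    have h2 := (Finset.card_le_card hsub).trans (Finset.card_union_le _ _)
    have h3 := Finset.card_union_le R S
    omega
  have hmatch : #(G.outerBoundary F ∩ A) ≤ #(S ∩ F) := by
    have himage : ({a : G.outerBoundary F | (a : V) ∈ A} : Finset (G.outerBoundary F)).image p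
        ⊆ S ∩ F := by
      intro y hy
      simp only [Finset.mem_image, Finset.mem_filter, Finset.mem_univ, true_and] at hy
      obtain ⟨a, ha, rfl⟩ := hy
      rcases hnbr a ha _ (hpF a).2 with h | h | h
      · exact (hAF _ h (hpF a).1).elim
      · exact (hRp a h).elim
      · exact Finset.mem_inter.2 ⟨h, (hpF a).1⟩
    refine le_trans (le_of_eq ?_) (Finset.card_le_card himage)
    rw [Finset.card_image_of_injective _ hp,
      ← Finset.card_image_of_injective _ Subtype.val_injective]
    congr 1
    ext y
    simp [and_comm]
  by_cases hA' : (A \ G.outerBoundary F).Nonempty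
  · obtain ⟨x, hx⟩ := hA'
    obtain ⟨y, hy⟩ := hB
    have hyA : y ∉ A := fun h => Finset.disjoint_left.1 hAB h hy
    have hyS : y ∉ S := Finset.disjoint_left.1 hBS hy
    have hcard : #((G.outerBoundary F ∩ A) ∪ (S \ F)) < k := by
      have h1 := Finset.card_union_le (G.outerBoundary F ∩ A) (S \ F)
      have h2 := Finset.card_inter_add_card_sdiff S F
      omega
    have hdisj : Disjoint (A \ G.outerBoundary F) ((G.outerBoundary F ∩ A) ∪ (S \ F)) := by
      rw [Finset.disjoint_left] at hAS ⊢
      intro z hz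
      rw [Finset.mem_sdiff] at hz
      simp [hz.2, hAS hz.1]
    obtain ⟨u, hu, v, hvA, hvS, huv⟩ := exists_adj_of_kConnected hG hcard hdisj hx
      (y := y) (by simp [hyA]) (by simp [hyA, hyS])
    rw [Finset.mem_sdiff] at hu
    have hvF : v ∉ F := fun h =>
      (mem_or_mem_outerBoundary h huv.symm).elim (hAF u hu.1) hu.2
    simp only [Finset.mem_union, Finset.mem_inter, Finset.mem_sdiff] at hvA hvS
    rcases hnbr u hu.1 v huv with h | h | h
    · by_cases h' : v ∈ G.outerBoundary F
      · exact hvS (Or.inl ⟨h', h⟩)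
      · exact hvA ⟨h, h'⟩
    · exact hvF (hRF h)
    · exact hvS (Or.inr ⟨h, hvF⟩)
  · obtain ⟨a, ha⟩ := hA
    rw [Finset.not_nonempty_iff_eq_empty, Finset.sdiff_eq_empty_iff_subset] at hA'
    rw [Finset.inter_eq_right.2 hA'] at hsmall
    have hsub : G.neighborFinset a ⊆ (A.erase a) ∪ (R ∪ S) := by
      intro v hv
      rw [mem_neighborFinset] at hv
      rcases hnbr a ha v hv with h | h | h
      · simp [h, hv.ne']
      · simp [h]
      · simp [h]
    have h1 := (Finset.card_le_card hsub).trans (Finset.card_union_le _ _)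
    rw [G.card_neighborFinset_eq_degree, Finset.card_erase_of_mem ha] at h1
    have h2 := Finset.card_union_le R S
    have h3 := hdeg a
    have h4 := Finset.card_pos.2 ⟨a, ha⟩
    omega

end OuterBoundary

end SimpleGraph

open SimpleGraph in
/-- A graph stays `k`-connected after deleting `R` if no separation of the graph has a separator
`R ∪ S` with `S` of fewer than `k` vertices. -/
theorem kConnected_induce_compl {V : Type*} [Fintype V] [DecidableEq V] {G : SimpleGraph V}
    {k : ℕ} (R : Finset V) (hcard : #R + k + 1 ≤ Fintype.card V)
    (h : ∀ S A B : Finset V, #S < k → (∀ v, v ∈ A ∨ v ∈ B ∨ v ∈ R ∨ v ∈ S) →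
      Disjoint A B → Disjoint A R → Disjoint B R → Disjoint A S → Disjoint B S →
      A.Nonempty → B.Nonempty → ∃ a ∈ A, ∃ b ∈ B, G.Adj a b) :
    KConnected (G.induce (R : Set V)ᶜ) k := by
  classical
  have hVcard : Nat.card ((R : Set V)ᶜ : Set V) = Fintype.card V - #R := by
    rw [Nat.card_eq_fintype_card, Fintype.card_compl_set]
    simp
  refine ⟨by omega, fun S hS => ?_⟩
  have hne : Nonempty (Sᶜ : Set ((R : Set V)ᶜ : Set V)) := by
    rw [Set.nonempty_coe_sort, ← Set.ncard_pos]
    have := Set.ncard_add_ncard_compl S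
    omega
  refine connected_of_forall_exists_adj fun A hA hAc => ?_
  let emb : (Sᶜ : Set ((R : Set V)ᶜ : Set V)) → V := fun x => x.1.1
  have hemb : Function.Injective emb := Subtype.val_injective.comp Subtype.val_injective
  have hembR : ∀ x, emb x ∉ R := fun x h => x.1.2 (Finset.mem_coe.2 h)
  have hembS : ∀ x, emb x ∉ S.toFinset.image Subtype.val := fun x hx => by
    obtain ⟨y, hy, hyx⟩ := Finset.mem_image.1 hx
    exact x.2 (Subtype.val_injective hyx ▸ Set.mem_toFinset.1 hy)
  obtain ⟨a, ha, b, hb, hab⟩ := h (S.toFinset.image Subtype.val) (A.toFinset.image emb)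
    (Aᶜ.toFinset.image emb)
    (by rwa [Finset.card_image_of_injective _ Subtype.val_injective, ← Set.ncard_eq_toFinset_card'])
    (fun v => by
      by_cases hvR : v ∈ R
      · exact Or.inr (Or.inr (Or.inl hvR))
      have hvR' : v ∈ (R : Set V)ᶜ := by simpa using hvR
      by_cases hvS : (⟨v, hvR'⟩ : ((R : Set V)ᶜ : Set V)) ∈ S
      · exact Or.inr (Or.inr (Or.inr (Finset.mem_image.2 ⟨_, Set.mem_toFinset.2 hvS, rfl⟩)))
      by_cases hvA : (⟨⟨v, hvR'⟩, hvS⟩ : (Sᶜ : Set ((R : Set V)ᶜ : Set V))) ∈ A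
      · exact Or.inl (Finset.mem_image.2 ⟨_, Set.mem_toFinset.2 hvA, rfl⟩)
      · exact Or.inr (Or.inl (Finset.mem_image.2 ⟨_, Set.mem_toFinset.2 hvA, rfl⟩)))
    (by
      rw [Finset.disjoint_image hemb, Set.disjoint_toFinset]
      exact disjoint_compl_right)
    (Finset.disjoint_left.2 (Finset.forall_mem_image.2 fun x _ => hembR x))
    (Finset.disjoint_left.2 (Finset.forall_mem_image.2 fun x _ => hembR x))
    (Finset.disjoint_left.2 (Finset.forall_mem_image.2 fun x _ => hembS x))
    (Finset.disjoint_left.2 (Finset.forall_mem_image.2 fun x _ => hembS x))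
    ((Set.toFinset_nonempty.2 hA).image _) ((Set.toFinset_nonempty.2 hAc).image _)
  obtain ⟨x, hx, rfl⟩ := Finset.mem_image.1 ha
  obtain ⟨y, hy, rfl⟩ := Finset.mem_image.1 hb
  exact ⟨x, Set.mem_toFinset.1 hx, y, Set.mem_toFinset.1 hy, hab⟩

theorem connectivity_keeping_tree_bipartite
    {V VT : Type} [Fintype V] [Fintype VT] [DecidableEq VT]
    (G : SimpleGraph V) [DecidableRel G.Adj] (T : SimpleGraph VT)
    (k m : ℕ) (hk : 1 ≤ k) (hm : 1 ≤ m)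
    (hT : T.IsTree) (horder : Fintype.card VT = m)
    -- (X, Y) is the bipartition of the tree T
    (X Y : Finset VT) (hXY : Disjoint X Y) (hcover : X ∪ Y = Finset.univ)
    (hbipT : ∀ a b : VT, T.Adj a b → (a ∈ X ↔ b ∈ Y))
    (hGconn : KConnected G k) (hGbip : G.Colorable 2)
    (hdeg : 2 * k + 2 * m + max X.card Y.card - 3 ≤ G.minDegree) :
    ∃ f : VT ↪ V, (∀ a b : VT, T.Adj a b → G.Adj (f a) (f b)) ∧
      KConnected (G.induce (Set.range f)ᶜ) k := by
  classical
  set t := k + m - 1 with ht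
  set M := max #X #Y with hM
  have hYX : ∀ a, a ∈ Y ↔ a ∉ X := fun a => by
    have h1 : a ∈ X ∪ Y := hcover ▸ Finset.mem_univ a
    rw [Finset.mem_union] at h1
    exact ⟨fun h h' => Finset.disjoint_left.1 hXY h' h, h1.resolve_left⟩
  have hMpos : 0 < M := by
    have h1 : #X + #Y = m := by
      rw [← Finset.card_union_of_disjoint hXY, hcover, Finset.card_univ, horder]
    omega
  have hdeg' : ∀ v, (2 * t - 1) + M ≤ G.degree v := fun v => by
    have := G.minDegree_le_degree v
    omega
  have : Nonempty V := (Nat.card_pos_iff.1 (by have := hGconn.1; omega)).1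
  obtain ⟨col₀⟩ := hGbip
  obtain ⟨col, hcol⟩ : ∃ col : V → Bool, ∀ a b, G.Adj a b → col b = !col a := by
    refine ⟨fun v => decide (col₀ v = 0), fun a b hab => ?_⟩
    have h := col₀.valid hab
    have key : ∀ i j : Fin 2, i ≠ j → decide (j = 0) = !decide (i = 0) := by decide
    exact key _ _ h
  obtain ⟨F, hF⟩ := G.exists_isMinimalFragment (2 * t - 1)
  obtain ⟨p, hp, hpF⟩ := hF.exists_matching (hF.card_outerBoundary_lt_card hcol hMpos hdeg')
  set P : Finset V := Finset.univ.image p with hP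
  have hPcard : ∀ b, #{y ∈ P | col y = b} ≤ #{y ∈ G.outerBoundary F | col y = !b} := fun b => by
    have hsub : {y ∈ P | col y = b} ⊆
        ({a : G.outerBoundary F | col a = !b} : Finset (G.outerBoundary F)).image p := by
      intro y hy
      simp only [hP, Finset.mem_filter, Finset.mem_image, Finset.mem_univ, true_and] at hy ⊢
      obtain ⟨⟨a, rfl⟩, hb⟩ := hy
      exact ⟨a, by rw [← hb, hcol _ _ (hpF a).2, Bool.not_not], rfl⟩
    refine (Finset.card_le_card hsub).trans (Finset.card_image_le.trans ?_)
    refine Finset.card_le_card_of_injOn Subtype.val (fun a ha => ?_) Subtype.val_injective.injOn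
    simpa using ha
  have havoid : ∀ (b : Bool) (Q : Finset V), (∀ y ∈ Q, col y = b) →
      M + #{y ∈ G.outerBoundary F | col y = !b} ≤ #Q → M ≤ #(Q \ P) := fun b Q hQ hle => by
    have h1 : Q ⊆ (Q \ P) ∪ {y ∈ P | col y = b} := fun y hy => by
      by_cases hyP : y ∈ P <;> simp [hy, hyP, hQ y hy]
    have h2 := (Finset.card_le_card h1).trans (Finset.card_union_le _ _)
    have h3 := hPcard b
    omega
  obtain ⟨f, hfadj, hfC⟩ := SimpleGraph.IsTree.exists_embedding_of_le_card_neighbors G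
    (fun b => {y ∈ F | col y = b} \ P) (fun _ => M)
    (Finset.disjoint_left.2 fun y h1 h2 => by
      simp only [Finset.mem_sdiff, Finset.mem_filter] at h1 h2
      exact Bool.noConfusion (h1.1.2.symm.trans h2.1.2))
    (fun b => Finset.card_pos.1 (hMpos.trans_le
      (havoid b _ (by simp) (hF.add_card_le_card_filter hcol hMpos hdeg' b))))
    (fun b x hx => by
      simp only [Finset.mem_sdiff, Finset.mem_filter] at hx
      refine (havoid b _ (by simp +contextual)
        (hF.add_card_le_card_neighbors hcol hdeg' hx.1.1 hx.1.2)).trans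
        (Finset.card_le_card fun y hy => ?_)
      simp only [Finset.mem_sdiff, Finset.mem_filter] at hy ⊢
      tauto)
    m T horder hT (fun a => decide (a ∈ X))
    (fun a b hab => by
      have h1 := hbipT a b hab
      rw [hYX] at h1
      by_cases ha : a ∈ X <;> by_cases hb : b ∈ X <;> simp_all)
    (fun b => by
      cases b
      · refine le_trans (Finset.card_le_card fun a ha => ?_) (le_max_right #X #Y)
        simpa [hYX] using ha
      · refine le_trans (Finset.card_le_card fun a ha => ?_) (le_max_left #X #Y)
        simpa using ha)
  refine ⟨f, hfadj, ?_⟩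
  simp only [Finset.mem_sdiff, Finset.mem_filter] at hfC
  set R : Finset V := Finset.univ.image f with hR
  have hRcard : #R = m := by
    rw [hR, Finset.card_image_of_injective _ f.injective, Finset.card_univ, horder]
  have hRF : R ⊆ F := Finset.image_subset_iff.2 fun a _ => (hfC a).1.1
  have hRne : R.Nonempty := Finset.card_pos.1 (by omega)
  have hRp : ∀ a, p a ∉ R := fun a ha => by
    obtain ⟨w, -, hw⟩ := Finset.mem_image.1 ha
    exact (hfC w).2 (hw ▸ Finset.mem_image_of_mem p (Finset.mem_univ a))
  have hrange : Set.range f = (R : Set V) := by simp [hR]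
  rw [hrange]
  have hdeg'' : ∀ v, 2 * t - 1 ≤ G.degree v := fun v => le_of_add_le_left (hdeg' v)
  refine kConnected_induce_compl R ?_ fun S A B hS hcov hAB hAR hBR hAS hBS hA hB => ?_
  · obtain ⟨v⟩ := this
    have h1 := G.degree_lt_card_verts v
    have h2 := hdeg' v
    omega
  · by_contra! hadj
    rcases le_total #(G.outerBoundary F ∩ A) #(G.outerBoundary F ∩ B) with hle | hle
    · exact hF.not_separated hGconn (by omega) hdeg'' hp hpF hRF hRne hRp hS (by omega) hcov hAB
        hAR hAS hBS hadj hA hB hle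
    · exact hF.not_separated hGconn (by omega) hdeg'' hp hpF hRF hRne hRp hS (by omega)
        (fun v => by have := hcov v; tauto) hAB.symm
        hBR hBS hAS (fun b hb a ha h => hadj a ha b hb h.symm) hB hA hle
end

section
/- Let p be a positive integer and let G be a triangle-free finite simple graph with minimum degree δ(G) ≥ 2p. Suppose (S₁, S₂, F) is a p-connected triple of G such that |V(F)| is as small as possible among all p-connected triples of G. Then |V(F)| > |S₁|, and there exists a matching M in G between S₁ and V(F) (every edge of M has one endpoint in S₁ and the other in V(F), and no two edges of M share a vertex) that saturates S₁ (every vertex of S₁ is incident with an edge of M). -/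
/-- In the graph `H` there exist `n` pairwise internally vertex-disjoint `u`–`v` paths:
`n` pairwise distinct paths from `u` to `v` such that any vertex lying on two of them
is an endpoint. -/
def InternallyDisjointPaths {W : Type*} (H : SimpleGraph W) (u v : W) (n : ℕ) : Prop :=
  ∃ P : Fin n → H.Walk u v,
    (∀ i, (P i).IsPath) ∧
    (∀ i j, i ≠ j → P i ≠ P j) ∧
    (∀ i j, i ≠ j → ∀ x, x ∈ (P i).support → x ∈ (P j).support → x = u ∨ x = v)

/-- `(S₁, S₂, Fs)` is a `p`-connected triple of `G`: `Fs` is the vertex set of a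
non-trivial connected component of `G - (S₁ ∪ S₂)`, such that
(i) `S₁ ∩ S₂ = ∅` and `|S₁ ∪ S₂| ≤ 2p - 1`;
(ii) every vertex of `S₁` has at most `p` neighbors in `Fs`;
(iii) every pair of distinct vertices of `S₂ ∪ Fs` is joined by at least `p + 1`
pairwise internally vertex-disjoint paths in `G[S₁ ∪ S₂ ∪ Fs]`. -/
def PConnectedTriple {V : Type*} (G : SimpleGraph V) (p : ℕ)
    (S₁ S₂ Fs : Set V) : Prop :=
  -- Fs is the vertex set of a non-trivial connected component of G - (S₁ ∪ S₂)
  Fs ⊆ (S₁ ∪ S₂)ᶜ ∧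
  2 ≤ Fs.ncard ∧
  (G.induce Fs).Connected ∧
  (∀ x ∈ Fs, ∀ y, y ∉ S₁ ∪ S₂ → G.Adj x y → y ∈ Fs) ∧
  -- (i)
  Disjoint S₁ S₂ ∧ (S₁ ∪ S₂).ncard ≤ 2 * p - 1 ∧
  -- (ii)
  (∀ v ∈ S₁, (G.neighborSet v ∩ Fs).ncard ≤ p) ∧
  -- (iii)
  (∀ u v : ↥(S₁ ∪ S₂ ∪ Fs), (u : V) ∈ S₂ ∪ Fs → (v : V) ∈ S₂ ∪ Fs → u ≠ v →
    InternallyDisjointPaths (G.induce (S₁ ∪ S₂ ∪ Fs)) u v (p + 1))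

open SimpleGraph

/-- `(X, T)` witnesses that the vertex set `T` separates `A` from `B` in `G`: the set `X` is
the part of `G - T` on the side of `A`. -/
def IsSeparation {V : Type*} (G : SimpleGraph V) (A B X T : Set V) : Prop :=
  Disjoint X T ∧ A ⊆ X ∪ T ∧ Disjoint X B ∧ ∀ a ∈ X, ∀ b, G.Adj a b → b ∈ X ∪ T

/-- There are `k` pairwise vertex-disjoint walks from `A` to `B` in `G`. -/
def IsLinked {V : Type*} (G : SimpleGraph V) (A B : Set V) (k : ℕ) : Prop :=
  ∃ (a b : Fin k → V) (w : ∀ i, G.Walk (a i) (b i)), (∀ i, a i ∈ A) ∧ (∀ i, b i ∈ B) ∧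
    ∀ i j x, x ∈ (w i).support → x ∈ (w j).support → i = j

/-- The graph on the same vertex set keeping only the edges of `G` inside `C`. -/
def edgesWithin {V : Type*} (G : SimpleGraph V) (C : Set V) : SimpleGraph V where
  Adj a b := G.Adj a b ∧ a ∈ C ∧ b ∈ C
  symm := ⟨fun _ _ h => ⟨h.1.symm, h.2.2, h.2.1⟩⟩
  loopless := ⟨fun _ h => G.irrefl h.1⟩

theorem edgesWithin_le {V : Type*} (G : SimpleGraph V) (C : Set V) : edgesWithin G C ≤ G :=
  fun _ _ h => h.1

theorem edgesWithin_lt {V : Type*} {G : SimpleGraph V} {C : Set V} {x y : V} (h : G.Adj x y)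
    (hC : x ∉ C ∨ y ∉ C) : edgesWithin G C < G := by
  refine lt_of_le_of_ne (edgesWithin_le G C) fun he => ?_
  have h' : (edgesWithin G C).Adj x y := by rwa [he]
  rcases hC with hC | hC
  exacts [hC h'.2.1, hC h'.2.2]

theorem support_subset_of_edgesWithin {V : Type*} {G : SimpleGraph V} {C : Set V} {a b : V}
    (w : (edgesWithin G C).Walk a b) (ha : a ∈ C) : ∀ x ∈ w.support, x ∈ C := by
  induction w with
  | nil => simpa using ha
  | cons h w ih =>
    intro x hx
    rw [Walk.support_cons, List.mem_cons] at hx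
    rcases hx with rfl | hx
    exacts [ha, ih h.2.2 x hx]

theorem IsLinked.mono {V : Type*} {G H : SimpleGraph V} (hle : G ≤ H) {A B : Set V} {k : ℕ}
    (h : IsLinked G A B k) : IsLinked H A B k := by
  obtain ⟨a, b, w, ha, hb, hw⟩ := h
  exact ⟨a, b, fun i => (w i).mapLe hle, ha, hb, by simpa using hw⟩

/-- If each of `k` disjoint walks passes through a chosen vertex of a `k`-element set `P`, then
the chosen vertices exhaust `P` and each walk meets `P` only in its chosen vertex. -/
theorem bijective_and_eq_of_mem_support {V : Type*} [Finite V] {G : SimpleGraph V} {k : ℕ}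
    {a b : Fin k → V} (w : ∀ i, G.Walk (a i) (b i)) {c : Fin k → V} {P : Set V}
    (hP : P.ncard = k) (hcw : ∀ i, c i ∈ (w i).support) (hc : ∀ i, c i ∈ P)
    (hw : ∀ i j x, x ∈ (w i).support → x ∈ (w j).support → i = j) :
    Function.Injective c ∧ (∀ z ∈ P, ∃ i, c i = z) ∧
      ∀ i, ∀ z ∈ P, z ∈ (w i).support → z = c i := by
  have hinj : Function.Injective c := fun i j h => hw i j (c i) (hcw i) (h ▸ hcw j)
  have hrange : Set.range c = P := by
    refine Set.eq_of_subset_of_ncard_le (by rintro _ ⟨i, rfl⟩; exact hc i) ?_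
    rw [hP, Set.ncard_range_of_injective hinj]
    simp
  have hsurj : ∀ z ∈ P, ∃ i, c i = z := fun z hz => by rwa [← hrange] at hz
  refine ⟨hinj, hsurj, fun i z hz hzi => ?_⟩
  obtain ⟨j, rfl⟩ := hsurj z hz
  rw [hw i j _ hzi (hcw j)]

/-- Gluing step of Menger's theorem: disjoint walks from `A` to `insert x S` on one side of the
edge `xy` and from `insert y S` to `B` on the other side combine to walks from `A` to `B`. -/
theorem isLinked_of_edge {V : Type*} [Finite V] {G : SimpleGraph V} {A B X S : Set V} {k : ℕ}
    {x y : V} (hxy : G.Adj x y) (hAX : A ⊆ X ∪ S) (hXS : Disjoint X S) (hx : x ∈ X)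
    (hy : y ∉ X ∪ S) (hk : S.ncard + 1 = k)
    (h₁ : IsLinked (edgesWithin G (X ∪ S)) A (insert x S) k)
    (h₂ : IsLinked (edgesWithin G Xᶜ) (insert y S) B k) : IsLinked G A B k := by
  have hxS : x ∉ S := Set.disjoint_left.1 hXS hx
  have hyS : y ∉ S := fun h => hy (Or.inr h)
  obtain ⟨a, b, w, ha, hb, hw⟩ := h₁
  obtain ⟨c, d, w', hc, hd, hw'⟩ := h₂
  obtain ⟨hbinj, -, hbP⟩ := bijective_and_eq_of_mem_support w (c := b)
    (by rw [Set.ncard_insert_of_notMem hxS, hk]) (fun i => (w i).end_mem_support) hb hw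
  obtain ⟨-, hcsurj, hcQ⟩ := bijective_and_eq_of_mem_support w' (c := c)
    (by rw [Set.ncard_insert_of_notMem hyS, hk]) (fun i => (w' i).start_mem_support) hc hw'
  have hmatch : ∀ i, ∃ j, (b i ∈ S ∧ c j = b i) ∨ (b i = x ∧ c j = y) := by
    intro i
    rcases hb i with h | h
    · obtain ⟨j, hj⟩ := hcsurj y (Or.inl rfl)
      exact ⟨j, Or.inr ⟨h, hj⟩⟩
    · obtain ⟨j, hj⟩ := hcsurj (b i) (Or.inr h)
      exact ⟨j, Or.inl ⟨h, hj⟩⟩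
  choose j hj using hmatch
  have hjinj : ∀ i i', j i = j i' → i = i' := by
    intro i i' h
    apply hbinj
    have := hj i
    have := hj i'
    rw [← h] at this
    grind
  have hglue : ∀ i, ∃ q : G.Walk (a i) (d (j i)),
      ∀ z ∈ q.support, z ∈ (w i).support ∨ z ∈ (w' (j i)).support := by
    intro i
    have hstep : ∃ q : G.Walk (b i) (c (j i)), ∀ z ∈ q.support, z = b i ∨ z = c (j i) := by
      rcases hj i with ⟨-, h⟩ | ⟨h, h'⟩
      · rw [h]
        exact ⟨.nil, by simp⟩
      · rw [h, h']
        exact ⟨hxy.toWalk, by simp⟩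
    obtain ⟨q, hq⟩ := hstep
    refine ⟨((w i).mapLe (edgesWithin_le _ _)).append
      (q.append ((w' (j i)).mapLe (edgesWithin_le _ _))), fun z hz => ?_⟩
    simp only [Walk.mem_support_append_iff, Walk.support_mapLe_eq_support] at hz
    rcases hz with h | h | h
    · exact Or.inl h
    · rcases hq z h with rfl | rfl
      exacts [Or.inl (w i).end_mem_support, Or.inr (w' (j i)).start_mem_support]
    · exact Or.inr h
  choose q hq using hglue
  have hmixed : ∀ i i' z, z ∈ (w i).support → z ∈ (w' (j i')).support → i = i' := by
    intro i i' z hz hz'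
    have h₁ := support_subset_of_edgesWithin _ (hAX (ha i)) z hz
    have h₂ := support_subset_of_edgesWithin (w' (j i'))
      (by rcases hc (j i') with h | h
          · rw [h]; exact fun h => hy (Or.inl h)
          · exact Set.disjoint_right.1 hXS h) z hz'
    have hzS : z ∈ S := h₁.resolve_left h₂
    have e₁ := hbP i z (Or.inr hzS) hz
    have e₂ := hcQ (j i') z (Or.inr hzS) hz'
    apply hbinj
    have := hj i'
    grind
  refine ⟨a, fun i => d (j i), q, ha, fun i => hd _, fun i i' z hz hz' => ?_⟩
  rcases hq i z hz with h | h <;> rcases hq i' z hz' with h' | h'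
  · exact hw _ _ z h h'
  · exact hmixed _ _ z h h'
  · exact (hmixed _ _ z h' h).symm
  · exact hjinj _ _ (hw' _ _ z h h')

/-- **Menger's theorem** for two vertex sets. -/
theorem isLinked_of_forall_isSeparation {V : Type*} [Finite V] (G : SimpleGraph V) :
    ∀ (A B : Set V) (k : ℕ), (∀ X T, IsSeparation G A B X T → k ≤ T.ncard) →
      IsLinked G A B k := by
  induction G using WellFoundedLT.induction with
  | ind G ih =>
  intro A B k hsep
  by_cases hG : ∃ x y, G.Adj x y
  swap
  · push Not at hG
    have hk := hsep (A \ B) (A ∩ B) ⟨by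
      rw [Set.disjoint_left]; grind, by grind, Set.disjoint_sdiff_left,
      fun a _ b h => (hG a b h).elim⟩
    obtain ⟨C, hC, hCk⟩ := Set.exists_subset_card_eq hk
    have hcard : Nat.card C = k := hCk
    obtain ⟨e⟩ : Nonempty (Fin k ≃ C) := ⟨(Finite.equivFinOfCardEq hcard).symm⟩
    refine ⟨fun i => e i, fun i => e i, fun i => .nil, fun i => (hC (e i).2).1,
      fun i => (hC (e i).2).2, fun i j x hi hj => ?_⟩
    simp only [Walk.support_nil, List.mem_singleton] at hi hj
    exact e.injective (Subtype.ext (hi.symm.trans hj))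
  obtain ⟨x₀, y₀, hxy₀⟩ := hG
  have hlt : G.deleteEdges {s(x₀, y₀)} < G := by
    refine lt_of_le_of_ne (deleteEdges_le _) fun h => ?_
    have h' := hxy₀
    rw [← h] at h'
    simp at h'
  by_cases hdel : ∀ X T, IsSeparation (G.deleteEdges {s(x₀, y₀)}) A B X T → k ≤ T.ncard
  · exact (ih _ hlt A B k hdel).mono hlt.le
  push Not at hdel
  obtain ⟨X, S, ⟨hXS, hAX, hXB, hcl⟩, hSk⟩ := hdel
  have hcross : ∃ x y, G.Adj x y ∧ x ∈ X ∧ y ∉ X ∪ S ∧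
      ∀ a ∈ X, ∀ b, G.Adj a b → b ∈ X ∪ S ∨ a = x ∧ b = y := by
    by_contra! hno
    refine absurd (hsep X S ⟨hXS, hAX, hXB, fun a ha b hab => ?_⟩) (by omega)
    by_contra hb
    obtain ⟨a', ha', b', hab', hb', hne⟩ := hno a b hab ha hb
    have key : ∀ c ∈ X, ∀ d, G.Adj c d → d ∉ X ∪ S → s(c, d) = s(x₀, y₀) := by
      intro c hc d hcd hd
      by_contra hne
      exact hd (hcl c hc d (deleteEdges_adj.2 ⟨hcd, hne⟩))
    have h := (key a ha b hab hb).trans (key a' ha' b' hab' hb').symm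
    rw [Sym2.eq_iff] at h
    rcases h with ⟨h, h'⟩ | ⟨h, h'⟩
    · exact hne h.symm h'.symm
    · exact hb' (h ▸ Or.inl ha)
  obtain ⟨x, y, hxy, hx, hy, hcross⟩ := hcross
  have hxS : x ∉ S := Set.disjoint_left.1 hXS hx
  have hk : S.ncard + 1 = k := by
    have := hsep (X \ {x}) (insert x S) ⟨by
      rw [Set.disjoint_left] at hXS ⊢; grind, by
      intro a ha; have := hAX ha; grind, hXB.mono_left Set.sdiff_subset, by
      intro a ha b hab
      have := hcross a ha.1 b hab
      grind⟩
    rw [Set.ncard_insert_of_notMem hxS] at this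
    omega
  refine isLinked_of_edge hxy hAX hXS hx hy hk
    (ih _ (edgesWithin_lt hxy (Or.inr hy)) _ _ _ ?_)
    (ih _ (edgesWithin_lt hxy (Or.inl (by simpa using hx))) _ _ _ ?_)
  · rintro X₁ T ⟨hXT, hA, hXP, hcl₁⟩
    rw [Set.disjoint_left] at hXP
    refine hsep (X₁ ∩ X) T ⟨hXT.mono_left Set.inter_subset_left, ?_,
      hXB.mono_left Set.inter_subset_right, ?_⟩
    · intro a ha
      have := hAX ha
      have := hA ha
      grind
    · rintro a ⟨ha₁, ha⟩ b hab
      have h₁ := hcross a ha b hab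
      have h₂ := hcl₁ a ha₁ b
      simp only [edgesWithin] at h₂
      grind
  · rintro X₂ T ⟨hXT, hQ, hXB₂, hcl₂⟩
    rw [Set.disjoint_left] at hXB₂ hXB
    refine hsep ((X ∪ X₂) \ T) T ⟨Set.disjoint_sdiff_left, ?_, ?_, ?_⟩
    · intro a ha
      have := hAX ha
      have := @hQ a
      grind
    · rw [Set.disjoint_left]
      grind
    · rintro a ⟨ha, haT⟩ b hab
      have h₁ := hcross a
      have h₂ := hcl₂ a
      simp only [edgesWithin, Set.mem_compl_iff] at h₂
      have := @hQ b
      grind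

/-- **Menger's theorem** for two non-adjacent vertices. -/
theorem internallyDisjointPaths_or_exists_separator {W : Type*} [Finite W] (H : SimpleGraph W) {u v : W}
    (huv : u ≠ v) (hadj : ¬ H.Adj u v) (k : ℕ) :
    InternallyDisjointPaths H u v k ∨
      ∃ X T : Set W, u ∈ X ∧ v ∉ X ∪ T ∧ Disjoint X T ∧ T.ncard < k ∧
        ∀ a ∈ X, ∀ b, H.Adj a b → b ∈ X ∪ T := by
  by_cases hsep : ∀ X T, IsSeparation (edgesWithin H {u, v}ᶜ) (H.neighborSet u) (H.neighborSet v)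
      X T → k ≤ T.ncard
  · left
    obtain ⟨a, b, w, ha, hb, hw⟩ := isLinked_of_forall_isSeparation _ _ _ _ hsep
    simp only [mem_neighborSet] at ha hb
    have hane : ∀ i, a i ∈ ({u, v}ᶜ : Set W) := by
      intro i
      simp only [Set.mem_compl_iff, Set.mem_insert_iff, Set.mem_singleton_iff, not_or]
      exact ⟨(ha i).ne', fun h => hadj (h ▸ ha i)⟩
    have hpath : ∀ i, ∃ q : H.Walk u v, q.IsPath ∧ a i ∈ q.support ∧
        ∀ x ∈ q.support, x = u ∨ x = v ∨ x ∈ (w i).support := by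
      classical
      intro i
      have hmem : ∀ x ∈ (w i).bypass.support, x ∈ (w i).support :=
        fun x hx => (w i).support_bypass_subset_support hx
      have hout : ∀ x ∈ (w i).bypass.support, x ≠ u ∧ x ≠ v := fun x hx => by
        simpa using support_subset_of_edgesWithin (w i) (hane i) x (hmem x hx)
      refine ⟨Walk.cons (ha i) (((w i).bypass.mapLe (edgesWithin_le _ _)).concat (hb i).symm),
        ?_, ?_, ?_⟩
      · rw [Walk.cons_isPath_iff, Walk.concat_isPath_iff, Walk.support_concat]
        simp only [Walk.support_mapLe_eq_support]
        refine ⟨⟨?_, fun h => (hout _ h).2 rfl⟩, fun h => ?_⟩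
        · rw [Walk.isPath_def, Walk.support_mapLe_eq_support, ← Walk.isPath_def]
          exact (w i).bypass_isPath
        · simp only [List.mem_append, List.mem_singleton] at h
          rcases h with h | h
          exacts [(hout _ h).1 rfl, huv h]
      · simp [Walk.support_concat]
      · intro x hx
        simp only [Walk.support_cons, Walk.support_concat, Walk.support_mapLe_eq_support,
          List.mem_cons, List.mem_append, List.not_mem_nil, or_false] at hx
        rcases hx with h | h | h
        exacts [Or.inl h, Or.inr (Or.inr (hmem x h)), Or.inr (Or.inl h)]
    choose q hq haq hsupp using hpath
    have hdisj : ∀ i j, i ≠ j → ∀ x, x ∈ (q i).support → x ∈ (q j).support → x = u ∨ x = v := by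
      intro i j hij x hi hj
      have := hsupp i x hi
      have := hsupp j x hj
      have := hw i j x
      grind
    refine ⟨q, hq, fun i j hij h => ?_, hdisj⟩
    have := hdisj i j hij (a i) (haq i) (h ▸ haq i)
    exact hane i (by simpa using this)
  · right
    push Not at hsep
    obtain ⟨X, T, ⟨hXT, hA, hXB, hcl⟩, hT⟩ := hsep
    rw [Set.disjoint_left] at hXT hXB
    refine ⟨insert u (X \ {v}), T \ {u, v}, by simp, by simp [huv.symm], ?_, ?_, ?_⟩
    · rw [Set.disjoint_left]
      grind
    · exact (Set.ncard_le_ncard Set.sdiff_subset).trans_lt hT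
    · intro a ha b hab
      have h₁ := @hA b
      have h₂ := hcl a
      simp only [mem_neighborSet, edgesWithin] at h₁ h₂ hXB
      have h₃ := @hXB a
      have := hab.symm
      have := hab.ne
      grind

/-- Adding the edge `uv` as one more path. -/
theorem InternallyDisjointPaths.succ_of_adj {W : Type*} {H : SimpleGraph W} {u v : W}
    (hadj : H.Adj u v) {k : ℕ} (h : InternallyDisjointPaths (H.deleteEdges {s(u, v)}) u v k) :
    InternallyDisjointPaths H u v (k + 1) := by
  obtain ⟨P, hP, hne, hdisj⟩ := h
  have hmap : ∀ i, (P i).mapLe (deleteEdges_le _) ≠ hadj.toWalk := by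
    intro i h
    have hs := congrArg Walk.edges h
    have hmem : s(u, v) ∈ (P i).edges := by
      have : s(u, v) ∈ hadj.toWalk.edges := by simp
      rw [← hs] at this
      simpa using this
    have := (P i).adj_of_mem_edges hmem
    simp at this
  refine ⟨Fin.cons hadj.toWalk fun i => (P i).mapLe (deleteEdges_le _), ?_, ?_, ?_⟩
  · intro i
    cases i using Fin.cases with
    | zero => simpa using hadj.ne
    | succ i =>
      simp only [Fin.cons_succ]
      rw [Walk.isPath_def, Walk.support_mapLe_eq_support, ← Walk.isPath_def]
      exact hP i
  · intro i j hij
    cases i using Fin.cases with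
    | zero =>
      cases j using Fin.cases with
      | zero => exact absurd rfl hij
      | succ j => simpa using (hmap j).symm
    | succ i =>
      cases j using Fin.cases with
      | zero => simpa using hmap i
      | succ j =>
        simp only [Fin.cons_succ]
        intro h
        refine hne i j (by simpa using hij) (Walk.ext_support ?_)
        simpa using congrArg Walk.support h
  · intro i j hij x hi hj
    cases i using Fin.cases with
    | zero => simpa using hi
    | succ i =>
      cases j using Fin.cases with
      | zero => simpa using hj
      | succ j =>
        simp only [Fin.cons_succ, Walk.support_mapLe_eq_support] at hi hj
        exact hdisj i j (by simpa using hij) x hi hj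

/-- A nonempty vertex set `F` whose outside neighbours lie in a set `S` of at most `2p - 1`
vertices. -/
def SmallBoundary {V : Type*} (G : SimpleGraph V) (p : ℕ) (S F : Set V) : Prop :=
  Disjoint S F ∧ S.ncard ≤ 2 * p - 1 ∧ F.Nonempty ∧ ∀ x ∈ F, ∀ y, G.Adj x y → y ∈ S ∪ F

theorem SmallBoundary.exists_adj {V : Type*} [Finite V] {G : SimpleGraph V} {p : ℕ}
    (hp : 1 ≤ p) (hdeg : ∀ v, 2 * p ≤ (G.neighborSet v).ncard) {S F : Set V}
    (h : SmallBoundary G p S F) {x : V} (hx : x ∈ F) : ∃ y ∈ F, G.Adj x y := by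
  by_contra! hno
  have hsub : G.neighborSet x ⊆ S := fun y hy =>
    (h.2.2.2 x hx y hy).resolve_right fun hyF => hno y hyF hy
  have := Set.ncard_le_ncard hsub
  have := hdeg x
  have := h.2.1
  omega

theorem SmallBoundary.lt_ncard {V : Type*} [Finite V] {G : SimpleGraph V} {p : ℕ}
    (hp : 1 ≤ p) (htf : G.CliqueFree 3) (hdeg : ∀ v, 2 * p ≤ (G.neighborSet v).ncard)
    {S F : Set V} (h : SmallBoundary G p S F) : 2 * p < F.ncard := by
  classical
  obtain ⟨x, hx⟩ := h.2.2.1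
  obtain ⟨y, hy, hxy⟩ := h.exists_adj hp hdeg hx
  have hdisj : Disjoint (G.neighborSet x) (G.neighborSet y) := by
    rw [Set.disjoint_left]
    intro z hz hz'
    exact htf {x, y, z} (is3Clique_triple_iff.2 ⟨hxy, hz, hz'⟩)
  have hsub : G.neighborSet x ∪ G.neighborSet y ⊆ S ∪ F :=
    Set.union_subset (h.2.2.2 x hx) (h.2.2.2 y hy)
  have h₁ := Set.ncard_le_ncard hsub
  rw [Set.ncard_union_eq hdisj] at h₁
  have := Set.ncard_union_le S F
  have := hdeg x
  have := hdeg y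
  have := h.2.1
  omega

theorem SmallBoundary.connected_of_minimal {V : Type*} [Finite V] {G : SimpleGraph V} {p : ℕ}
    {S F : Set V} (h : SmallBoundary G p S F)
    (hmin : ∀ S' F', SmallBoundary G p S' F' → F.ncard ≤ F'.ncard) :
    (G.induce F).Connected := by
  obtain ⟨x, hx⟩ := h.2.2.1
  rw [connected_iff_exists_forall_reachable]
  refine ⟨⟨x, hx⟩, ?_⟩
  set Z : Set V := {z | ∃ hz : z ∈ F, (G.induce F).Reachable ⟨x, hx⟩ ⟨z, hz⟩} with hZ
  have hZF : Z ⊆ F := fun z hz => hz.1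
  have hcl : SmallBoundary G p S Z := by
    refine ⟨h.1.mono_right hZF, h.2.1, ⟨x, hx, .refl _⟩, ?_⟩
    rintro z ⟨hz, hr⟩ y hy
    rcases h.2.2.2 z hz y hy with hyS | hyF
    · exact Or.inl hyS
    · exact Or.inr ⟨hyF, hr.trans (Adj.reachable (by simpa using hy))⟩
  have hEq : Z = F := Set.eq_of_subset_of_ncard_le hZF (hmin _ _ hcl)
  rintro ⟨z, hz⟩
  rw [← hEq] at hz
  exact hz.2

theorem inter_nonempty_of_adj_mem {V : Type*} [Finite V] {G : SimpleGraph V} {p : ℕ}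
    {S F X T : Set V} {u : V} (hu : u ∈ F ∨ p < (G.neighborSet u ∩ F).ncard) (huX : u ∈ X)
    (hT : T.ncard ≤ p) (hcl : ∀ a ∈ X, ∀ b ∈ S ∪ F, G.Adj a b → b ∈ X ∪ T) :
    (F ∩ X).Nonempty := by
  rcases hu with hu | hu
  · exact ⟨u, hu, huX⟩
  · obtain ⟨b, ⟨hb, hbF⟩, hbT⟩ := Set.exists_mem_notMem_of_ncard_lt_ncard (hT.trans_lt hu)
    exact ⟨b, hbF, (hcl u huX b (Or.inr hbF) hb).resolve_right hbT⟩

/-- One side of a small separation gives a set with small boundary. -/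
theorem SmallBoundary.inter {V : Type*} [Finite V] {G : SimpleGraph V} {p : ℕ}
    {S F X T : Set V} (h : SmallBoundary G p S F) (hXT : Disjoint X T) (hT : T.ncard ≤ p)
    (hS : (S ∩ X).ncard < p) (hF : (F ∩ X).Nonempty)
    (hcl : ∀ a ∈ X, ∀ b ∈ S ∪ F, G.Adj a b → b ∈ X ∪ T) :
    SmallBoundary G p (S ∩ X ∪ T) (F ∩ X) := by
  refine ⟨?_, ?_, hF, ?_⟩
  · have := h.1
    rw [Set.disjoint_left] at this hXT ⊢
    grind
  · have := Set.ncard_union_le (S ∩ X) T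
    omega
  · rintro x ⟨hxF, hxX⟩ y hxy
    have h₁ := h.2.2.2 x hxF y hxy
    have h₂ := hcl x hxX y h₁ hxy
    grind

/-- If `F` has minimum size among sets with small boundary, then no two vertices of `F`, or with
many neighbours in `F`, can be separated by few vertices. -/
theorem SmallBoundary.no_separation_of_minimal {V : Type*} [Finite V] {G : SimpleGraph V} {p : ℕ}
    (hp : 1 ≤ p) {S F : Set V} (h : SmallBoundary G p S F)
    (hmin : ∀ S' F', SmallBoundary G p S' F' → F.ncard ≤ F'.ncard) {u v : V}
    (hu : u ∈ F ∨ p < (G.neighborSet u ∩ F).ncard) (hv : v ∈ F ∨ p < (G.neighborSet v ∩ F).ncard)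
    {X Y T₁ T₂ : Set V} (huX : u ∈ X) (hvY : v ∈ Y) (hXY : Disjoint X Y)
    (hXT : Disjoint X T₁) (hYT : Disjoint Y T₂) (hT₁ : T₁.ncard ≤ p) (hT₂ : T₂.ncard ≤ p)
    (hX : ∀ a ∈ X, ∀ b ∈ S ∪ F, G.Adj a b → b ∈ X ∪ T₁)
    (hY : ∀ a ∈ Y, ∀ b ∈ S ∪ F, G.Adj a b → b ∈ Y ∪ T₂) : False := by
  have hFX := inter_nonempty_of_adj_mem hu huX hT₁ hX
  have hFY := inter_nonempty_of_adj_mem hv hvY hT₂ hY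
  have hsplit : (F ∩ X).ncard + (F ∩ Y).ncard ≤ F.ncard := by
    rw [← Set.ncard_union_eq (hXY.mono Set.inter_subset_right Set.inter_subset_right)]
    exact Set.ncard_le_ncard (by grind)
  have hsplitS : (S ∩ X).ncard + (S ∩ Y).ncard ≤ S.ncard := by
    rw [← Set.ncard_union_eq (hXY.mono Set.inter_subset_right Set.inter_subset_right)]
    exact Set.ncard_le_ncard (by grind)
  have := hFX.ncard_pos
  have := hFY.ncard_pos
  have hSle := h.2.1
  rcases Nat.lt_or_ge (S ∩ X).ncard p with hSX | hSX
  · have := hmin _ _ (h.inter hXT hT₁ hSX hFX hX)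
    omega
  · have := hmin _ _ (h.inter hYT hT₂ (by omega) hFY hY)
    omega

theorem SmallBoundary.internallyDisjointPaths_of_minimal {V : Type*} [Finite V]
    {G : SimpleGraph V} {p : ℕ} (hp : 1 ≤ p) {S F U : Set V} (hU : U = S ∪ F)
    (h : SmallBoundary G p S F)
    (hmin : ∀ S' F', SmallBoundary G p S' F' → F.ncard ≤ F'.ncard) {u v : U} (huv : u ≠ v)
    (hu : (u : V) ∈ F ∨ p < (G.neighborSet u ∩ F).ncard)
    (hv : (v : V) ∈ F ∨ p < (G.neighborSet v ∩ F).ncard) :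
    InternallyDisjointPaths (G.induce U) u v (p + 1) := by
  have himg : ∀ X : Set U, ((↑) '' X : Set V).ncard = X.ncard := fun X =>
    Set.ncard_image_of_injective X Subtype.val_injective
  have hdisj : ∀ {X Y : Set U}, Disjoint X Y → Disjoint ((↑) '' X : Set V) ((↑) '' Y) :=
    fun h => (Set.disjoint_image_iff Subtype.val_injective).2 h
  have hlift : ∀ X T : Set U, (∀ a ∈ X, ∀ b, (G.induce U).Adj a b → b ∈ X ∪ T) →
      ∀ a ∈ ((↑) '' X : Set V), ∀ b ∈ S ∪ F, G.Adj a b → b ∈ ((↑) '' X ∪ (↑) '' T : Set V) := by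
    rintro X T hcl _ ⟨a, ha, rfl⟩ b hb hab
    rw [← Set.image_union]
    exact ⟨⟨b, hU ▸ hb⟩, hcl a ha _ hab, rfl⟩
  by_cases hadj : (G.induce U).Adj u v
  · rcases internallyDisjointPaths_or_exists_separator
        ((G.induce U).deleteEdges {s(u, v)}) huv (by simp) p with
      hP | ⟨X, T, huX, hvXT, hXT, hTp, hcl⟩
    · exact hP.succ_of_adj hadj
    exfalso
    have hcl' : ∀ a ∈ X, ∀ b, (G.induce U).Adj a b → b ∈ X ∪ T ∨ a = u ∧ b = v := by
      intro a ha b hab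
      by_cases he : s(a, b) = s(u, v)
      · rw [Sym2.eq_iff] at he
        grind
      · exact Or.inl (hcl a ha b (deleteEdges_adj.2 ⟨hab, he⟩))
    have hXT' := Set.disjoint_left.1 hXT
    refine h.no_separation_of_minimal hp hmin hu hv (X := (↑) '' X) (Y := (↑) '' (X ∪ T)ᶜ)
      (T₁ := (↑) '' insert v T) (T₂ := (↑) '' insert u T) ⟨u, huX, rfl⟩ ⟨v, hvXT, rfl⟩
      (hdisj ?_) (hdisj ?_) (hdisj ?_) ?_ ?_ (hlift _ _ ?_) (hlift _ _ ?_)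
    · rw [Set.disjoint_left]
      grind
    · rw [Set.disjoint_left]
      grind
    · rw [Set.disjoint_left]
      grind
    · rw [himg]
      exact (Set.ncard_insert_le v T).trans hTp
    · rw [himg]
      exact (Set.ncard_insert_le u T).trans hTp
    · intro a ha b hab
      have := hcl' a ha b hab
      grind
    · intro a ha b hab
      have := hcl' b
      have := hab.symm
      grind
  · rcases internallyDisjointPaths_or_exists_separator (G.induce U) huv hadj (p + 1) with
      hP | ⟨X, T, huX, hvXT, hXT, hTp, hcl⟩
    · exact hP
    exfalso
    have hTp' : ((↑) '' T : Set V).ncard ≤ p := by rw [himg]; omega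
    refine h.no_separation_of_minimal hp hmin hu hv (X := (↑) '' X) (Y := (↑) '' (X ∪ T)ᶜ)
      (T₁ := (↑) '' T) (T₂ := (↑) '' T) ⟨u, huX, rfl⟩ ⟨v, hvXT, rfl⟩
      (hdisj ?_) (hdisj hXT) (hdisj ?_) hTp' hTp' (hlift _ _ hcl) (hlift _ _ ?_)
    · rw [Set.disjoint_left]
      grind
    · rw [Set.disjoint_left]
      grind
    · intro a ha b hab
      have := hcl b
      have := hab.symm
      grind

/-- A set of minimum size among those with small boundary carries a `p`-connected triple. -/
theorem SmallBoundary.pConnectedTriple_of_minimal {V : Type*} [Finite V] {G : SimpleGraph V}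
    {p : ℕ} (hp : 1 ≤ p) (hdeg : ∀ v, 2 * p ≤ (G.neighborSet v).ncard) {S F : Set V}
    (h : SmallBoundary G p S F)
    (hmin : ∀ S' F', SmallBoundary G p S' F' → F.ncard ≤ F'.ncard) :
    PConnectedTriple G p {v ∈ S | (G.neighborSet v ∩ F).ncard ≤ p}
      {v ∈ S | p < (G.neighborSet v ∩ F).ncard} F := by
  have hunion : {v ∈ S | (G.neighborSet v ∩ F).ncard ≤ p} ∪
      {v ∈ S | p < (G.neighborSet v ∩ F).ncard} = S := by
    ext v
    have := le_or_gt (G.neighborSet v ∩ F).ncard p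
    simp only [Set.mem_union, Set.mem_ofPred_eq]
    tauto
  refine ⟨?_, ?_, h.connected_of_minimal hmin, ?_, ?_, ?_, fun v hv => hv.2, ?_⟩
  · rw [hunion]
    exact h.1.subset_compl_left
  · obtain ⟨x, hx⟩ := h.2.2.1
    obtain ⟨y, hy, hxy⟩ := h.exists_adj hp hdeg hx
    exact (Set.one_lt_ncard).2 ⟨x, hx, y, hy, hxy.ne⟩
  · rw [hunion]
    exact fun x hx y hy hxy => (h.2.2.2 x hx y hxy).resolve_left hy
  · rw [Set.disjoint_left]
    exact fun v hv hv' => absurd hv'.2 (not_lt.2 hv.2)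
  · rw [hunion]
    exact h.2.1
  · intro u v hu hv huv
    refine h.internallyDisjointPaths_of_minimal hp (by rw [hunion]) hmin huv ?_ ?_
    · exact hu.symm.imp_right And.right
    · exact hv.symm.imp_right And.right

theorem PConnectedTriple.smallBoundary {V : Type*} {G : SimpleGraph V} {p : ℕ}
    {S₁ S₂ F : Set V} (h : PConnectedTriple G p S₁ S₂ F) : SmallBoundary G p (S₁ ∪ S₂) F := by
  obtain ⟨hF, htwo, -, hcl, -, hcard, -⟩ := h
  refine ⟨Set.subset_compl_iff_disjoint_left.1 hF, hcard,
    Set.nonempty_of_ncard_ne_zero (by omega), fun x hx y hxy => ?_⟩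
  by_cases hy : y ∈ S₁ ∪ S₂
  · exact Or.inl hy
  · exact Or.inr (hcl x hx y hy hxy)

/-- The component of a minimal triple has minimum size among sets with small boundary. -/
theorem ncard_le_of_smallBoundary {V : Type*} [Finite V] {G : SimpleGraph V} {p : ℕ}
    (hp : 1 ≤ p) (hdeg : ∀ v, 2 * p ≤ (G.neighborSet v).ncard) {F : Set V}
    (hmin : ∀ S₁' S₂' F', PConnectedTriple G p S₁' S₂' F' → F.ncard ≤ F'.ncard)
    {S' F' : Set V} (h : SmallBoundary G p S' F') : F.ncard ≤ F'.ncard := by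
  obtain ⟨F₀, ⟨S₀, h₀⟩, hF₀⟩ := Set.exists_min_image {F | ∃ S, SmallBoundary G p S F} Set.ncard
    (Set.toFinite _) ⟨F', S', h⟩
  exact (hmin _ _ _ (h₀.pConnectedTriple_of_minimal hp hdeg fun S F hSF => hF₀ F ⟨S, hSF⟩)).trans
    (hF₀ F' ⟨S', h⟩)

/-- Hall's condition for the neighbourhoods in `F` of a part of the boundary. -/
theorem SmallBoundary.hall_of_minimal {V : Type*} [Finite V] {G : SimpleGraph V} {p : ℕ}
    {S F : Set V} (h : SmallBoundary G p S F) (hlt : S.ncard < F.ncard)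
    (hmin : ∀ S' F', SmallBoundary G p S' F' → F.ncard ≤ F'.ncard) {A : Set V} (hA : A ⊆ S) :
    A.ncard ≤ {x ∈ F | ∃ a ∈ A, G.Adj a x}.ncard := by
  by_contra! hB
  set B := {x ∈ F | ∃ a ∈ A, G.Adj a x} with hBdef
  have hAS := Set.ncard_le_ncard hA
  obtain ⟨x, hxF, hxB⟩ := Set.exists_mem_notMem_of_ncard_lt_ncard
    (show B.ncard < F.ncard by omega)
  have hB' : (insert x B).ncard ≤ A.ncard := (Set.ncard_insert_le x B).trans hB
  have hsub : insert x B ⊆ F := Set.insert_subset hxF fun z hz => hz.1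
  have hnew : SmallBoundary G p (S \ A ∪ insert x B) (F \ insert x B) := by
    refine ⟨?_, ?_, ?_, ?_⟩
    · have := h.1
      rw [Set.disjoint_left] at this ⊢
      grind
    · have h₁ := Set.ncard_union_le (S \ A) (insert x B)
      have h₂ := Set.ncard_sdiff_add_ncard_of_subset hA
      have h₃ := h.2.1
      omega
    · obtain ⟨z, hz, hz'⟩ := Set.exists_mem_notMem_of_ncard_lt_ncard
        (show (insert x B).ncard < F.ncard by omega)
      exact ⟨z, hz, hz'⟩
    · rintro a ⟨haF, haB⟩ b hab
      have h₁ := h.2.2.2 a haF b hab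
      have h₂ : b ∉ A := fun hb => haB (Or.inr ⟨haF, b, hb, hab.symm⟩)
      grind
  have h₁ := hmin _ _ hnew
  have h₂ := Set.ncard_sdiff_add_ncard_of_subset hsub
  have h₃ : 0 < (insert x B).ncard := (Set.insert_nonempty x B).ncard_pos
  omega

theorem matching_in_minimal_connected_triple
    {V : Type} [Fintype V] (G : SimpleGraph V) [DecidableRel G.Adj]
    (p : ℕ) (hp : 1 ≤ p) (htf : G.CliqueFree 3) (hdeg : 2 * p ≤ G.minDegree)
    (S₁ S₂ Fs : Set V) (htriple : PConnectedTriple G p S₁ S₂ Fs)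
    (hmin : ∀ S₁' S₂' Fs' : Set V, PConnectedTriple G p S₁' S₂' Fs' →
      Fs.ncard ≤ Fs'.ncard) :
    S₁.ncard < Fs.ncard ∧
    -- a matching between S₁ and Fs saturating S₁, given by its system of partners
    ∃ f : V → V, Set.InjOn f S₁ ∧ ∀ s ∈ S₁, f s ∈ Fs ∧ G.Adj s (f s) := by
  classical
  have hdeg' : ∀ v, 2 * p ≤ (G.neighborSet v).ncard := fun v => by
    rw [Set.ncard_eq_toFinset_card']
    exact hdeg.trans (G.minDegree_le_degree v)
  have hbd := htriple.smallBoundary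
  have hlt : (S₁ ∪ S₂).ncard < Fs.ncard := by
    have := hbd.lt_ncard hp htf hdeg'
    have := hbd.2.1
    omega
  refine ⟨(Set.ncard_le_ncard Set.subset_union_left).trans_lt hlt, ?_⟩
  obtain ⟨f, hf, hft⟩ := (Finset.all_card_le_biUnion_card_iff_exists_injective
    (fun s : S₁ => {x : V | x ∈ Fs ∧ G.Adj s x}.toFinset)).1 fun s => by
      have h := hbd.hall_of_minimal hlt
        (fun _ _ h' => ncard_le_of_smallBoundary hp hdeg' hmin h')
        (A := (↑) '' (s : Set S₁)) (by rintro _ ⟨a, -, rfl⟩; exact Or.inl a.2)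
      rw [Set.ncard_image_of_injective _ Subtype.val_injective, Set.ncard_coe_finset] at h
      refine h.trans_eq ?_
      rw [← Set.ncard_coe_finset]
      congr 1
      ext x
      simp
  refine ⟨fun v => if h : v ∈ S₁ then f ⟨v, h⟩ else v, ?_, ?_⟩
  · intro a ha b hb hab
    simp only [ha, hb, dif_pos] at hab
    exact congrArg Subtype.val (hf hab)
  · intro s hs
    simpa [hs] using hft ⟨s, hs⟩
end

section
/- Let p and k be positive integers with p ≥ k, and let G be a k-connected triangle-free finite simple graph with minimum degree δ(G) ≥ 2p. Suppose (S₁, S₂, F) is a p-connected triple of G, and there exists a matching M in G between S₁ and V(F) that saturates S₁. Then for any vertex set R ⊆ V(F) \ V(M) of size p − k + 1, the graph G − R is still k-connected. -/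
/-- A connected graph has an edge leaving every proper non-empty vertex set. -/
theorem exists_adj_of_induce_compl_connected {V : Type*} {G : SimpleGraph V} {S D : Set V}
    (h : (G.induce Sᶜ).Connected) (hDS : Disjoint D S) {a x : V} (ha : a ∈ D)
    (hxD : x ∉ D) (hxS : x ∉ S) : ∃ a ∈ D, ∃ b, b ∉ D ∧ b ∉ S ∧ G.Adj a b := by
  have haS : a ∉ S := Set.disjoint_left.1 hDS ha
  obtain ⟨w⟩ := h.preconnected ⟨a, haS⟩ ⟨x, hxS⟩
  obtain ⟨d, -, h1, h2⟩ := w.exists_boundary_dart (Subtype.val ⁻¹' D) ha hxD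
  exact ⟨d.fst, h1, d.snd, h2, d.snd.2, d.adj⟩

/-- A non-empty graph is connected if every two vertices lie on the same side of every
partition of the vertex set without crossing edges. -/
theorem connected_of_forall_closed {W : Type*} [Nonempty W] {H : SimpleGraph W}
    (h : ∀ (C : Set W) (u v : W), u ∈ C → v ∉ C →
      (∀ a ∈ C, ∀ b, H.Adj a b → b ∈ C) → False) : H.Connected where
  preconnected u v := by
    by_contra huv
    exact h {w | H.Reachable u w} u v (SimpleGraph.Reachable.refl u) huv
      fun a ha b hab => SimpleGraph.Reachable.trans ha hab.reachable
  nonempty := inferInstance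

/-- If `n` internally disjoint paths join `u ∈ C` to `v ∉ C`, then a set which avoids `v` and `C`
and contains the neighbours of `C` outside `C` has at least `n` vertices. -/
theorem InternallyDisjointPaths.le_ncard {V : Type*} [Finite V] {G : SimpleGraph V}
    {U C T : Set V} {u v : U} {n : ℕ} (h : InternallyDisjointPaths (G.induce U) u v n)
    (hCT : Disjoint C T) (hC : ∀ a ∈ C, ∀ b, G.Adj a b → b ∉ T → b ∈ C)
    (hu : (u : V) ∈ C) (hv : (v : V) ∉ C) (hvT : (v : V) ∉ T) : n ≤ T.ncard := by
  obtain ⟨P, -, -, hP⟩ := h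
  have key : ∀ i, ∃ x : U, x ∈ (P i).support ∧ (x : V) ∈ T := by
    intro i
    obtain ⟨d, hd, h1, h2⟩ := (P i).exists_boundary_dart (Subtype.val ⁻¹' C) hu hv
    refine ⟨d.snd, (P i).dart_snd_mem_support_of_mem_darts hd, ?_⟩
    by_contra hT
    exact h2 (hC _ h1 _ d.adj hT)
  choose g hg hgT using key
  have hinj : Function.Injective fun i => (⟨g i, hgT i⟩ : T) := by
    intro i j hij
    by_contra hne
    have hgij : g i = g j := Subtype.ext (congrArg (fun t : T => (t : V)) hij)
    rcases hP i j hne (g i) (hg i) (hgij ▸ hg j) with h | h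
    · exact Set.disjoint_left.1 hCT hu (h ▸ hgT i)
    · exact hvT (h ▸ hgT i)
  simpa [Set.ncard] using Nat.card_le_card_of_injective _ hinj

/-- In a triangle-free graph the ends of an edge have disjoint neighbourhoods. -/
theorem disjoint_neighborSet_of_adj {V : Type*} {G : SimpleGraph V} (htf : G.CliqueFree 3)
    {x y : V} (hxy : G.Adj x y) : Disjoint (G.neighborSet x) (G.neighborSet y) := by
  classical
  refine Set.disjoint_left.2 fun z hx hy => htf {x, y, z} ?_
  exact SimpleGraph.is3Clique_triple_iff.2 ⟨hxy, hx, hy⟩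

/-- The component of a `p`-connected triple is large when the graph is triangle-free with
minimum degree at least `2p`. -/
theorem PConnectedTriple.two_mul_lt_ncard {V : Type*} [Finite V] {G : SimpleGraph V} {p : ℕ}
    (htf : G.CliqueFree 3) (hdeg : ∀ v, 2 * p ≤ (G.neighborSet v).ncard)
    {S₁ S₂ Fs : Set V} (ht : PConnectedTriple G p S₁ S₂ Fs) (hp : 1 ≤ p) :
    2 * p < Fs.ncard := by
  obtain ⟨-, h2, hconn, hcl, -, hcard, -, -⟩ := ht
  obtain ⟨x, hx, y, hy, hxy⟩ := (Set.one_lt_ncard_iff_nontrivial.1 h2)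
  have : Nontrivial Fs := ⟨⟨x, hx⟩, ⟨y, hy⟩, fun h => hxy (congrArg Subtype.val h)⟩
  obtain ⟨z, hz⟩ := hconn.preconnected.exists_adj_of_nontrivial ⟨x, hx⟩
  have hsub : ∀ w ∈ Fs, G.neighborSet w ⊆ (S₁ ∪ S₂) ∪ Fs := fun w hw b hb => by
    by_cases hbS : b ∈ S₁ ∪ S₂
    · exact Or.inl hbS
    · exact Or.inr (hcl w hw b hbS hb)
  have h1 := Set.ncard_union_eq (disjoint_neighborSet_of_adj htf (x := x) (y := z) hz)
  have h3 := Set.ncard_le_ncard (Set.union_subset (hsub x hx) (hsub z z.2))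
  have h4 := Set.ncard_union_le (S₁ ∪ S₂) Fs
  have := hdeg x
  have := hdeg z
  omega

/-- After deleting `R ∪ S`, every union of components of the remaining graph meets `S₂ ∪ Fs`. -/
theorem PConnectedTriple.not_disjoint_of_closed {V : Type*} [Finite V] {G : SimpleGraph V}
    {p k : ℕ} (hpk : k ≤ p) (hG : KConnected G k)
    (hdeg : ∀ v, 2 * p ≤ (G.neighborSet v).ncard)
    {S₁ S₂ Fs : Set V} (ht : PConnectedTriple G p S₁ S₂ Fs)
    {f : V → V} (hinj : Set.InjOn f S₁) (hf : ∀ s ∈ S₁, f s ∈ Fs ∧ G.Adj s (f s))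
    {R S C : Set V} (hR : R ⊆ Fs \ (S₁ ∪ f '' S₁)) (hS : S.ncard < k)
    (hFs : ∃ x ∈ Fs, x ∉ R ∪ S) (hCT : Disjoint C (R ∪ S))
    (hC : ∀ a ∈ C, ∀ b, G.Adj a b → b ∉ R ∪ S → b ∈ C) (hne : C.Nonempty) :
    ¬ Disjoint C (S₂ ∪ Fs) := by
  intro hdis
  obtain ⟨hFsub, -, -, hcl, -, -, hS₁, -⟩ := ht
  have hCF : ∀ a ∈ C, a ∉ Fs := fun a ha h => Set.disjoint_left.1 hdis ha (Or.inr h)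
  have hCS₂ : ∀ a ∈ C, a ∉ S₂ := fun a ha h => Set.disjoint_left.1 hdis ha (Or.inl h)
  set A := C ∩ S₁
  have hfA : f '' A ⊆ S ∩ Fs := by
    rintro _ ⟨s, ⟨hsC, hs⟩, rfl⟩
    obtain ⟨hsF, hadj⟩ := hf s hs
    refine ⟨?_, hsF⟩
    by_contra hsS
    refine hCF _ (hC s hsC _ hadj ?_) hsF
    rintro (h | h)
    · exact (hR h).2 (Or.inr ⟨s, hs, rfl⟩)
    · exact hsS h
  have hcard : (A ∪ S \ Fs).ncard ≤ S.ncard := by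
    have h1 : (f '' A).ncard = A.ncard :=
      Set.InjOn.ncard_image (hinj.mono Set.inter_subset_right)
    have h2 := Set.ncard_le_ncard hfA
    have h3 := Set.ncard_inter_add_ncard_sdiff_eq_ncard S Fs
    have h4 := Set.ncard_union_le A (S \ Fs)
    omega
  have hCA : C ⊆ S₁ := by
    intro c hc
    by_contra hcS
    obtain ⟨x, hxF, hxT⟩ := hFs
    have hD : Disjoint (C \ S₁) (A ∪ S \ Fs) := by
      refine Set.disjoint_left.2 ?_
      rintro y ⟨hyC, hyS⟩ (hy | hy)
      · exact hyS hy.2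
      · exact Set.disjoint_left.1 hCT hyC (Or.inr hy.1)
    obtain ⟨a, ⟨haC, haS⟩, b, hbD, hbS, hab⟩ := exists_adj_of_induce_compl_connected
      (hG.2 (A ∪ S \ Fs) (by omega)) hD (a := c) (x := x) ⟨hc, hcS⟩
      (fun h => hCF x h.1 hxF) (by
        rintro (h | h)
        · exact hCF x h.1 hxF
        · exact h.2 hxF)
    have hbF : b ∉ Fs := fun hbF => hCF a haC
      (hcl b hbF a (by rintro (h | h); exacts [haS h, hCS₂ a haC h]) hab.symm)
    have hbC : b ∉ C := fun h => by
      by_cases hb : b ∈ S₁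
      · exact hbS (Or.inl ⟨h, hb⟩)
      · exact hbD ⟨h, hb⟩
    refine hbC (hC a haC b hab ?_)
    rintro (h | h)
    · exact hbF (hR h).1
    · exact hbS (Or.inr ⟨h, hbF⟩)
  obtain ⟨s, hs⟩ := hne
  have hsub : G.neighborSet s ⊆ (G.neighborSet s ∩ Fs) ∪ (A ∪ S \ Fs) := by
    intro b hb
    by_cases hbF : b ∈ Fs
    · exact Or.inl ⟨hb, hbF⟩
    refine Or.inr ?_
    by_cases hbT : b ∈ R ∪ S
    · rcases hbT with h | h
      · exact absurd (hR h).1 hbF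
      · exact Or.inr ⟨h, hbF⟩
    · have := hC s hs b hb hbT
      exact Or.inl ⟨this, hCA this⟩
  have h1 := Set.ncard_le_ncard hsub
  have h2 := Set.ncard_union_le (G.neighborSet s ∩ Fs) (A ∪ S \ Fs)
  have h3 := hS₁ s (hCA hs)
  have h4 := hdeg s
  omega

theorem deletion_keeps_k_connected
    {V : Type} [Fintype V] (G : SimpleGraph V) [DecidableRel G.Adj]
    (p k : ℕ) (hk : 1 ≤ k) (hpk : k ≤ p)
    (hGconn : KConnected G k) (htf : G.CliqueFree 3) (hdeg : 2 * p ≤ G.minDegree)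
    (S₁ S₂ Fs : Set V) (htriple : PConnectedTriple G p S₁ S₂ Fs)
    -- a matching between S₁ and Fs saturating S₁, given by its system of partners;
    -- its vertex set V(M) is S₁ ∪ f '' S₁
    (f : V → V) (hinj : Set.InjOn f S₁) (hf : ∀ s ∈ S₁, f s ∈ Fs ∧ G.Adj s (f s)) :
    ∀ R : Set V, R ⊆ Fs \ (S₁ ∪ f '' S₁) → R.ncard = p - k + 1 →
      KConnected (G.induce Rᶜ) k := by
  intro R hR hRcard
  have hdeg' : ∀ v, 2 * p ≤ (G.neighborSet v).ncard := fun v => by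
    rw [← Nat.card_coe_set_eq, Nat.card_eq_fintype_card, SimpleGraph.card_neighborSet_eq_degree]
    exact hdeg.trans (G.minDegree_le_degree v)
  have hFcard := htriple.two_mul_lt_ncard htf hdeg' (hk.trans hpk)
  refine ⟨?_, fun S' hS' => ?_⟩
  · have h1 := Set.ncard_add_ncard_compl R
    have h2 := Set.ncard_le_card Fs
    rw [Nat.card_coe_set_eq]
    omega
  set S : Set V := Subtype.val '' S' with hSdef
  have hS : S.ncard < k := by
    rwa [hSdef, Set.ncard_image_of_injective _ Subtype.val_injective]
  have hT : (R ∪ S).ncard ≤ p := by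
    have := Set.ncard_union_le R S
    omega
  have hFs : ∃ x ∈ Fs, x ∉ R ∪ S := Set.exists_mem_notMem_of_ncard_lt_ncard (by omega)
  have hmem : ∀ x, x ∉ R ∪ S → ∃ w : ↥S'ᶜ, ((w : ↥Rᶜ) : V) = x := fun x hx =>
    ⟨⟨⟨x, fun h => hx (Or.inl h)⟩, fun h => hx (Or.inr ⟨_, h, rfl⟩)⟩, rfl⟩
  have hnotMem : ∀ w : ↥S'ᶜ, ((w : ↥Rᶜ) : V) ∉ R ∪ S := by
    rintro w (h | ⟨y, hy, hyw⟩)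
    · exact w.1.2 h
    · exact w.2 (Subtype.ext hyw ▸ hy)
  have : Nonempty ↥S'ᶜ := by
    obtain ⟨x, -, hx⟩ := hFs
    exact ⟨(hmem x hx).choose⟩
  refine connected_of_forall_closed fun C₀ u v hu hv hC₀ => ?_
  let φ : ↥S'ᶜ → V := fun w => ((w : ↥Rᶜ) : V)
  have hφ : Function.Injective φ := Subtype.val_injective.comp Subtype.val_injective
  have hdisj : ∀ D : Set ↥S'ᶜ, Disjoint (φ '' D) (R ∪ S) := fun D => by
    refine Set.disjoint_left.2 ?_
    rintro _ ⟨w, -, rfl⟩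
    exact hnotMem w
  have hclosed : ∀ D : Set ↥S'ᶜ,
      (∀ a ∈ D, ∀ b, ((G.induce Rᶜ).induce S'ᶜ).Adj a b → b ∈ D) →
      ∀ a ∈ φ '' D, ∀ b, G.Adj a b → b ∉ R ∪ S → b ∈ φ '' D := by
    rintro D hD _ ⟨a, ha, rfl⟩ b hab hb
    obtain ⟨w, rfl⟩ := hmem b hb
    exact ⟨w, hD a ha w hab, rfl⟩
  have hC₀' : ∀ a ∈ C₀ᶜ, ∀ b, ((G.induce Rᶜ).induce S'ᶜ).Adj a b → b ∈ C₀ᶜ :=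
    fun a ha b hab hb => ha (hC₀ b hb a hab.symm)
  have meets : ∀ D : Set ↥S'ᶜ, D.Nonempty →
      (∀ a ∈ D, ∀ b, ((G.induce Rᶜ).induce S'ᶜ).Adj a b → b ∈ D) →
      ∃ w ∈ D, φ w ∈ S₂ ∪ Fs := fun D hne hD => by
    obtain ⟨_, ⟨w, hw, rfl⟩, h⟩ := Set.not_disjoint_iff.1 <| htriple.not_disjoint_of_closed hpk
      hGconn hdeg' hinj hf hR hS hFs (hdisj D) (hclosed D hD) (hne.image φ)
    exact ⟨w, hw, h⟩
  obtain ⟨x, hx, hxF⟩ := meets C₀ ⟨u, hu⟩ hC₀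
  obtain ⟨y, hy, hyF⟩ := meets C₀ᶜ ⟨v, hv⟩ hC₀'
  have hsub : S₂ ∪ Fs ⊆ S₁ ∪ S₂ ∪ Fs := Set.union_subset_union_left _ Set.subset_union_right
  have hyC : φ y ∉ φ '' C₀ := fun h => hy ((hφ.mem_set_image).1 h)
  have hxC : φ x ∈ φ '' C₀ := ⟨x, hx, rfl⟩
  obtain ⟨-, -, -, -, -, -, -, hpaths⟩ := htriple
  have := (hpaths ⟨φ x, hsub hxF⟩ ⟨φ y, hsub hyF⟩ hxF hyF
    (fun h => hyC (Subtype.mk.inj h ▸ hxC))).le_ncard (hdisj C₀) (hclosed C₀ hC₀)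
    hxC hyC (hnotMem y)
  omega
end

section
/- Let G be a bipartite finite simple graph and let T be a tree with bipartition (X, Y). If δ(G) ≥ max{|X|, |Y|}, then G contains a subgraph T' isomorphic to T. -/
namespace SimpleGraph

variable {V W : Type*} {G : SimpleGraph V}

/-- A graph with positive minimum degree that is properly 2-coloured has vertices of both colours. -/
lemma Coloring.exists_eq_of_minDegree_pos [Fintype V] [DecidableRel G.Adj]
    (c : G.Coloring Bool) (h : 0 < G.minDegree) (b : Bool) : ∃ v, c v = b := by
  cases isEmpty_or_nonempty V with
  | inl _ => simp at h
  | inr hV =>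
    obtain ⟨v⟩ := hV
    obtain ⟨w, hw⟩ := (G.degree_pos_iff_exists_adj v).1 (h.trans_le (G.minDegree_le_degree v))
    have := c.valid hw
    by_cases hv : c v = b
    · exact ⟨v, hv⟩
    · exact ⟨w, (Bool.eq_not_of_ne this.symm).trans (Bool.eq_not_of_ne (Ne.symm hv)).symm⟩

/-- A tree with a 2-colouring embeds colour-preservingly into any 2-coloured graph whose minimum
degree is at least the size of each colour class of the tree. -/
theorem IsTree.exists_embedding_of_card_color_le_minDegree [Fintype V] [DecidableRel G.Adj]
    (c : G.Coloring Bool) [Fintype W] {T : SimpleGraph W} (hT : T.IsTree) (d : T.Coloring Bool)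
    (hd : ∀ b, (Finset.univ.filter fun x ↦ d x = b).card ≤ G.minDegree) :
    ∃ f : W ↪ V, (∀ x, c (f x) = d x) ∧ ∀ x y, T.Adj x y → G.Adj (f x) (f y) := by
  classical
  induction hn : Fintype.card W using Nat.strong_induction_on generalizing W with
  | _ n ih =>
    have := hT.connected.nonempty
    cases subsingleton_or_nontrivial W with
    | inl _ =>
      obtain ⟨x⟩ := this
      have hpos : 0 < G.minDegree :=
        (Finset.card_pos.2 ⟨x, by simp⟩).trans_le (hd (d x))
      obtain ⟨v, hv⟩ := c.exists_eq_of_minDegree_pos hpos (d x)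
      refine ⟨⟨fun _ ↦ v, fun _ _ _ ↦ Subsingleton.elim _ _⟩, fun y ↦ ?_, fun y z h ↦ ?_⟩
      · rw [Subsingleton.elim y x]
        exact hv
      · exact (h.ne (Subsingleton.elim _ _)).elim
    | inr _ =>
      obtain ⟨l, hl⟩ := hT.exists_vert_degree_one_of_nontrivial
      obtain ⟨u, hu, huniq⟩ := (T.degree_eq_one_iff_existsUnique_adj).1 hl
      have hS : (T.induce {l}ᶜ).IsTree :=
        ⟨hT.connected.induce_compl_singleton_of_degree_eq_one hl, hT.isAcyclic.induce _⟩
      let e : T.induce ({l}ᶜ : Set W) →g T := (Embedding.induce _).toHom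
      have hcard (b : Bool) :
          (Finset.univ.filter fun x : ({l}ᶜ : Set W) ↦ d x = b).card ≤
            ((Finset.univ.filter fun x ↦ d x = b).erase l).card :=
        Finset.card_le_card_of_injOn Subtype.val
          (fun x hx ↦ Finset.mem_erase.2
            ⟨x.2, Finset.mem_filter.2 ⟨Finset.mem_univ _, (Finset.mem_filter.1 hx).2⟩⟩) Subtype.val_injective.injOn
      obtain ⟨f, hfc, hf⟩ := ih (Fintype.card ({l}ᶜ : Set W))
        (hn ▸ Fintype.card_subtype_lt (x := l) (by simp)) hS (d.comp e)
        (fun b ↦ ((hcard b).trans (Finset.card_erase_le)).trans (hd b)) rfl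
      let u' : ({l}ᶜ : Set W) := ⟨u, hu.ne'⟩
      have hlt : ((Finset.univ.filter fun x : ({l}ᶜ : Set W) ↦ d x = d l).map f).card <
          (G.neighborFinset (f u')).card := by
        rw [Finset.card_map, card_neighborFinset_eq_degree]
        exact ((hcard _).trans_lt (Finset.card_erase_lt_of_mem (by simp))).trans_le
          ((hd _).trans (G.minDegree_le_degree _))
      obtain ⟨w, hw, hwf⟩ := Finset.exists_mem_notMem_of_card_lt_card hlt
      rw [mem_neighborFinset] at hw
      have hfc' (x : ({l}ᶜ : Set W)) : c (f x) = d x := hfc x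
      have hwc : c w = d l := by
        have h : c (f u') = d u := hfc' u'
        rw [Bool.eq_not_of_ne (c.valid hw).symm, Bool.eq_not_of_ne (d.valid hu), h]
      have hwne (x : ({l}ᶜ : Set W)) : f x ≠ w := by
        rintro rfl
        exact hwf (Finset.mem_map_of_mem _ (by simpa [hfc'] using hwc))
      let g (x : W) : V := if h : x = l then w else f ⟨x, h⟩
      have hgl : g l = w := dif_pos rfl
      have hg {x : W} (h : x ≠ l) : g x = f ⟨x, h⟩ := dif_neg h
      refine ⟨⟨g, fun x y hxy ↦ ?_⟩, fun x ↦ ?_, fun x y hxy ↦ ?_⟩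
      · rcases eq_or_ne x l with hx | hx <;> rcases eq_or_ne y l with hy | hy
        · exact hx.trans hy.symm
        · subst hx
          exact (hwne _ ((hg hy).symm.trans (hxy.symm.trans hgl))).elim
        · subst hy
          exact (hwne _ ((hg hx).symm.trans (hxy.trans hgl))).elim
        · rw [hg hx, hg hy] at hxy
          exact congrArg Subtype.val (f.injective hxy)
      · change c (g x) = d x
        rcases eq_or_ne x l with rfl | hx
        · rw [hgl, hwc]
        · rw [hg hx, hfc']
      · change G.Adj (g x) (g y)
        rcases eq_or_ne x l with hx | hx <;> rcases eq_or_ne y l with hy | hy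
        · exact (hxy.ne (hx.trans hy.symm)).elim
        · subst hx
          obtain rfl := huniq y hxy
          rw [hgl, hg hy]
          exact hw.symm
        · subst hy
          obtain rfl := huniq x hxy.symm
          rw [hgl, hg hx]
          exact hw
        · rw [hg hx, hg hy]
          exact hf ⟨x, hx⟩ ⟨y, hy⟩ hxy

end SimpleGraph

theorem tree_embedding_bipartite_minDegree
    {V VT : Type} [Fintype V] [Fintype VT] [DecidableEq VT]
    (G : SimpleGraph V) [DecidableRel G.Adj] (T : SimpleGraph VT)
    (hT : T.IsTree)
    -- (X, Y) is the bipartition of the tree T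
    (X Y : Finset VT) (hXY : Disjoint X Y) (hcover : X ∪ Y = Finset.univ)
    (hbipT : ∀ a b : VT, T.Adj a b → (a ∈ X ↔ b ∈ Y))
    (hGbip : G.Colorable 2)
    (hdeg : max X.card Y.card ≤ G.minDegree) :
    ∃ f : VT ↪ V, ∀ a b : VT, T.Adj a b → G.Adj (f a) (f b) := by
  have hY (a : VT) : a ∈ Y ↔ a ∉ X :=
    ⟨fun ha hX ↦ Finset.disjoint_left.1 hXY hX ha, fun ha ↦
      (Finset.mem_union.1 (hcover ▸ Finset.mem_univ a)).resolve_left ha⟩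
  let d : T.Coloring Bool := SimpleGraph.Coloring.mk (fun a ↦ decide (a ∈ X)) fun {a b} h ↦ by
    have := hbipT a b h
    rw [hY] at this
    grind
  have hd (b : Bool) : (Finset.univ.filter fun a ↦ d a = b).card ≤ G.minDegree := by
    have hda (a : VT) : d a = decide (a ∈ X) := rfl
    cases b
    · have : (Finset.univ.filter fun a ↦ d a = false) = Y := by ext a; simp [hda, hY]
      exact this ▸ (le_max_right _ _).trans hdeg
    · have : (Finset.univ.filter fun a ↦ d a = true) = X := by ext a; simp [hda]
      exact this ▸ (le_max_left _ _).trans hdeg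
  obtain ⟨f, -, hf⟩ := hT.exists_embedding_of_card_color_le_minDegree
    (hGbip.toColoring (α := Bool) (by simp)) d hd
  exact ⟨f, hf⟩
end

section
/- Let k be a positive integer. Every k-connected finite simple graph G with minimum degree δ(G) ≥ ⌊3k/2⌋ + 2 contains an edge e = uv such that G − {u, v} is still k-connected. -/
open Finset

/-- `(A, S, B)` is a separation of `G - D`: `A` and `B` are nonempty, no edge joins `A` to `B`,
and `A`, `S`, `B` partition the complement of `D`. -/
structure IsSeparation_s8 {V : Type*} (G : SimpleGraph V) (D A S B : Finset V) : Prop where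
  left_nonempty : A.Nonempty
  right_nonempty : B.Nonempty
  disjoint_left_sep : Disjoint A S
  disjoint_left_right : Disjoint A B
  disjoint_sep_right : Disjoint S B
  mem_iff : ∀ v, (v ∈ A ∨ v ∈ S ∨ v ∈ B) ↔ v ∉ D
  not_adj : ∀ a ∈ A, ∀ b ∈ B, ¬ G.Adj a b

/-- Every separation of `G - D` has a separator with at least `k` vertices. -/
def SeparatorsLarge {V : Type*} (G : SimpleGraph V) (k : ℕ) (D : Finset V) : Prop :=
  ∀ A S B, IsSeparation_s8 G D A S B → k ≤ #S

namespace IsSeparation_s8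

variable {V : Type*} {G : SimpleGraph V} {D A S B A' S' B' : Finset V} {k : ℕ} {x : V}

theorem symm (h : IsSeparation_s8 G D A S B) : IsSeparation_s8 G D B S A where
  left_nonempty := h.right_nonempty
  right_nonempty := h.left_nonempty
  disjoint_left_sep := h.disjoint_sep_right.symm
  disjoint_left_right := h.disjoint_left_right.symm
  disjoint_sep_right := h.disjoint_left_sep.symm
  mem_iff v := by rw [← h.mem_iff]; tauto
  not_adj a ha b hb hab := h.not_adj b hb a ha hab.symm

variable [DecidableEq V]

theorem card_eq_of_forall_notMem (h : IsSeparation_s8 G D A S B) {X : Finset V}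
    (hX : ∀ v ∈ X, v ∉ D) : #X = #(X ∩ A) + #(X ∩ S) + #(X ∩ B) := by
  have h1 := h.disjoint_left_sep
  have h2 := h.disjoint_left_right
  have h3 := h.disjoint_sep_right
  have hXe : X = X ∩ A ∪ X ∩ S ∪ X ∩ B := by
    ext v
    have := h.mem_iff v
    have := hX v
    simp only [mem_union, mem_inter]
    tauto
  rw [Finset.disjoint_left] at h1 h2 h3
  conv_lhs => rw [hXe]
  rw [card_union_of_disjoint, card_union_of_disjoint]
  · rw [Finset.disjoint_left]; intro v; simp only [mem_inter]; have := @h1 v; tauto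
  · rw [Finset.disjoint_left]; intro v; simp only [mem_inter, mem_union]
    have := @h2 v; have := @h3 v; tauto

theorem card_left (h : IsSeparation_s8 G D A S B) (h' : IsSeparation_s8 G D A' S' B') :
    #A = #(A ∩ A') + #(A ∩ S') + #(A ∩ B') :=
  h'.card_eq_of_forall_notMem fun v hv => (h.mem_iff v).1 (.inl hv)

theorem card_sep (h : IsSeparation_s8 G D A S B) (h' : IsSeparation_s8 G D A' S' B') :
    #S = #(S ∩ A') + #(S ∩ S') + #(S ∩ B') :=
  h'.card_eq_of_forall_notMem fun v hv => (h.mem_iff v).1 (.inr (.inl hv))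

theorem exists_corner [Fintype V] (h : IsSeparation_s8 G D A S B) (h' : IsSeparation_s8 G D A' S' B')
    (hne : (A ∩ A').Nonempty) :
    ∃ T C, IsSeparation_s8 G D (A ∩ A') T C ∧ #T = #(A ∩ S') + #(S ∩ S') + #(S ∩ A') := by
  have h1 := h.disjoint_left_sep
  have h2 := h.disjoint_left_right
  have h3 := h.disjoint_sep_right
  have h1' := h'.disjoint_left_sep
  have h2' := h'.disjoint_left_right
  have h3' := h'.disjoint_sep_right
  rw [Finset.disjoint_left] at h1 h2 h3 h1' h2' h3'
  refine ⟨A ∩ S' ∪ S ∩ S' ∪ S ∩ A',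
    univ.filter fun v => v ∉ D ∧ (v ∈ B ∨ v ∈ B'), ?_, ?_⟩
  · constructor
    · exact hne
    · obtain ⟨b, hb⟩ := h.right_nonempty
      exact ⟨b, by simp [hb, (h.mem_iff b).1 (.inr (.inr hb))]⟩
    · rw [Finset.disjoint_left]; intro v; simp only [mem_inter, mem_union]
      have := @h1 v; have := @h1' v; tauto
    · rw [Finset.disjoint_left]; intro v; simp only [mem_inter, mem_filter, mem_univ]
      have := @h2 v; have := @h2' v; tauto
    · rw [Finset.disjoint_left]; intro v; simp only [mem_inter, mem_union, mem_filter, mem_univ]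
      have := @h2 v; have := @h2' v; have := @h3 v; have := @h3' v; tauto
    · intro v
      have := h.mem_iff v; have := h'.mem_iff v
      simp only [mem_inter, mem_union, mem_filter, mem_univ]
      tauto
    · intro a ha b hb
      simp only [mem_inter, mem_filter, mem_univ, true_and] at ha hb
      rcases hb.2 with hb | hb
      · exact h.not_adj a ha.1 b hb
      · exact h'.not_adj a ha.2 b hb
  · rw [card_union_of_disjoint, card_union_of_disjoint]
    · rw [Finset.disjoint_left]; intro v; simp only [mem_inter]; have := @h1 v; tauto
    · rw [Finset.disjoint_left]; intro v; simp only [mem_inter, mem_union]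
      have := @h1' v; tauto

theorem le_card_corner [Fintype V] (hD : SeparatorsLarge G k D)
    (h : IsSeparation_s8 G D A S B) (h' : IsSeparation_s8 G D A' S' B') (hne : (A ∩ A').Nonempty) :
    k ≤ #(A ∩ S') + #(S ∩ S') + #(S ∩ A') := by
  obtain ⟨T, C, hT, hc⟩ := h.exists_corner h' hne
  exact hc ▸ hD _ _ _ hT

/-- A smallest fragment that meets a minimum separator is contained in it. -/
theorem left_inter_left_eq_empty [Fintype V] (hD : SeparatorsLarge G k D)
    (h : IsSeparation_s8 G D A S B) (hS : #S = k)
    (hmin : ∀ X Y Z, IsSeparation_s8 G D X Y Z → #Y = k → #A ≤ #X)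
    (h' : IsSeparation_s8 G D A' S' B') (hS' : #S' = k) (hmeet : (A ∩ S').Nonempty) :
    A ∩ A' = ∅ := by
  by_contra hne
  rw [← ne_eq, ← nonempty_iff_ne_empty] at hne
  obtain ⟨T, C, hT, hc⟩ := h.exists_corner h' hne
  have hkT := hD _ _ _ hT
  have hA := h.card_left h'
  have hpos := hmeet.card_pos
  have hTk : #T ≠ k := fun e => by have := hmin _ _ _ hT e; omega
  have e1 := h.card_sep h'
  have e2 := h'.card_sep h
  rw [inter_comm S' A, inter_comm S' S, inter_comm S' B] at e2
  have hBB : B ∩ B' = ∅ := by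
    by_contra hne'
    rw [← ne_eq, ← nonempty_iff_ne_empty] at hne'
    have := le_card_corner hD h.symm h'.symm hne'
    omega
  have e3 := h'.symm.card_left h
  rw [inter_comm B' A, inter_comm B' S, inter_comm B' B, hBB, card_empty] at e3
  have := hmin _ _ _ h'.symm hS'
  omega

/-- A smallest fragment with more than `k / 2` vertices meets no minimum separator. -/
theorem disjoint_of_minimal [Fintype V] (hD : SeparatorsLarge G k D)
    (h : IsSeparation_s8 G D A S B) (hS : #S = k)
    (hmin : ∀ X Y Z, IsSeparation_s8 G D X Y Z → #Y = k → #A ≤ #X) (hA : k < 2 * #A)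
    (h' : IsSeparation_s8 G D A' S' B') (hS' : #S' = k) : Disjoint A S' := by
  by_contra hmeet
  rw [Finset.disjoint_iff_inter_eq_empty, ← ne_eq, ← nonempty_iff_ne_empty] at hmeet
  have hl := left_inter_left_eq_empty hD h hS hmin h' hS' hmeet
  have hr := left_inter_left_eq_empty hD h hS hmin h'.symm hS' hmeet
  have a0 := h.card_left h'
  rw [hl, hr, card_empty] at a0
  have b0 := h.symm.card_left h'
  have a1 := h'.card_left h
  rw [inter_comm A' A, inter_comm A' S, inter_comm A' B, hl, card_empty] at a1
  have b1 := h'.symm.card_left h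
  rw [inter_comm B' A, inter_comm B' S, inter_comm B' B, hr, card_empty] at b1
  have e1 := h.card_sep h'
  have e2 := h'.card_sep h
  rw [inter_comm S' A, inter_comm S' S, inter_comm S' B] at e2
  have m0 := hmin _ _ _ h.symm hS
  have m1 := hmin _ _ _ h' hS'
  have m2 := hmin _ _ _ h'.symm hS'
  have c1 : #(B ∩ A') = 0 ∨ k ≤ #(B ∩ S') + #(S ∩ S') + #(S ∩ A') := by
    rcases (B ∩ A').eq_empty_or_nonempty with e | e
    · exact .inl (card_eq_zero.2 e)
    · exact .inr (le_card_corner hD h.symm h' e)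
  have c2 : #(B ∩ B') = 0 ∨ k ≤ #(B ∩ S') + #(S ∩ S') + #(S ∩ B') := by
    rcases (B ∩ B').eq_empty_or_nonempty with e | e
    · exact .inl (card_eq_zero.2 e)
    · exact .inr (le_card_corner hD h.symm h'.symm e)
  omega

/-- Deleting a vertex outside all minimum separators keeps all separators large. -/
theorem _root_.SeparatorsLarge.insert_vertex (hD : SeparatorsLarge G k D) (hx : x ∉ D)
    (hsep : ∀ A S B, IsSeparation_s8 G D A S B → #S = k → x ∉ S) :
    SeparatorsLarge G k (insert x D) := by
  intro A S B h
  have hm := fun v => h.mem_iff v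
  simp only [mem_insert, not_or] at hm
  have hxm := hm x
  have hxS : x ∉ S := by tauto
  have h' : IsSeparation_s8 G D A (insert x S) B := by
    refine ⟨h.left_nonempty, h.right_nonempty, ?_, h.disjoint_left_right, ?_, ?_, h.not_adj⟩
    · rw [disjoint_insert_right]; exact ⟨by tauto, h.disjoint_left_sep⟩
    · rw [disjoint_insert_left]; exact ⟨by tauto, h.disjoint_sep_right⟩
    · intro v
      have := hm v
      rw [mem_insert]
      by_cases hv : v = x
      · subst hv; tauto
      · tauto
  have h1 := hD _ _ _ h'
  have h2 := hsep _ _ _ h'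
  rw [card_insert_of_notMem hxS] at h1 h2
  by_contra hlt
  exact h2 (by omega) (mem_insert_self _ _)

theorem erase_right (h : IsSeparation_s8 G D A S B) (hx : x ∈ B) (hB : 2 ≤ #B) :
    IsSeparation_s8 G (insert x D) A S (B.erase x) := by
  have h2 := h.disjoint_left_right
  have h3 := h.disjoint_sep_right
  refine ⟨h.left_nonempty, ?_, h.disjoint_left_sep, h2.mono_right (erase_subset _ _),
    h3.mono_right (erase_subset _ _), ?_, fun a ha b hb => h.not_adj a ha b (mem_of_mem_erase hb)⟩
  · rw [← card_pos, card_erase_of_mem hx]; omega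
  · intro v
    rw [Finset.disjoint_left] at h2 h3
    have := h.mem_iff v
    simp only [mem_erase, mem_insert]
    by_cases hv : v = x
    · subst hv
      have := @h2 v; have := @h3 v
      tauto
    · tauto

theorem erase_sep (h : IsSeparation_s8 G D A S B) (hx : x ∈ S) :
    IsSeparation_s8 G (insert x D) A (S.erase x) B := by
  have h1 := h.disjoint_left_sep
  have h3 := h.disjoint_sep_right
  refine ⟨h.left_nonempty, h.right_nonempty, h1.mono_right (erase_subset _ _),
    h.disjoint_left_right, h3.mono_left (erase_subset _ _), ?_, h.not_adj⟩
  intro v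
  rw [Finset.disjoint_left] at h1 h3
  have := h.mem_iff v
  simp only [mem_erase, mem_insert]
  by_cases hv : v = x
  · subst hv
    have := @h1 v; have := @h3 v
    tauto
  · tauto

theorem insert_right (h : IsSeparation_s8 G (insert x D) A S B) (hx : x ∉ D)
    (hadj : ∀ a ∈ A, ¬ G.Adj x a) : IsSeparation_s8 G D A S (insert x B) := by
  have hm := fun v => h.mem_iff v
  simp only [mem_insert, not_or] at hm
  have hxm := hm x
  refine ⟨h.left_nonempty, insert_nonempty _ _, h.disjoint_left_sep, ?_, ?_, ?_, ?_⟩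
  · rw [disjoint_insert_right]; exact ⟨by tauto, h.disjoint_left_right⟩
  · rw [disjoint_insert_right]; exact ⟨by tauto, h.disjoint_sep_right⟩
  · intro v
    have := hm v
    rw [mem_insert]
    by_cases hv : v = x
    · subst hv; tauto
    · tauto
  · intro a ha b hb hab
    rcases mem_insert.1 hb with rfl | hb
    · exact hadj a ha hab.symm
    · exact h.not_adj a ha b hb hab

theorem minDegree_lt [Fintype V] [DecidableRel G.Adj] (h : IsSeparation_s8 G D A S B) :
    G.minDegree < #A + #S + #D := by
  obtain ⟨a, ha⟩ := h.left_nonempty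
  have hsub : insert a (G.neighborFinset a) ⊆ A ∪ S ∪ D := by
    intro v hv
    rcases mem_insert.1 hv with rfl | hv
    · simp [ha]
    · have := h.mem_iff v
      have hvB : v ∉ B := fun hb => h.not_adj a ha v hb (by simpa using hv)
      simp only [mem_union]
      tauto
  have h1 := card_le_card hsub
  rw [card_insert_of_notMem (by simp), SimpleGraph.card_neighborFinset_eq_degree] at h1
  have h2 := G.minDegree_le_degree a
  have h3 := card_union_le (A ∪ S) D
  have h4 := card_union_le A S
  omega

end IsSeparation_s8

section

variable {V : Type*} {G : SimpleGraph V} {k : ℕ}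

theorem KConnected.separatorsLarge (h : KConnected G k) : SeparatorsLarge G k ∅ := by
  intro A S B hs
  by_contra hlt
  have hc := h.2 (S : Set V) (by rw [Set.ncard_coe_finset]; omega)
  obtain ⟨a, ha⟩ := hs.left_nonempty
  obtain ⟨b, hb⟩ := hs.right_nonempty
  have h1 := Finset.disjoint_left.1 hs.disjoint_left_sep
  have h2 := Finset.disjoint_left.1 hs.disjoint_left_right
  have h3 := Finset.disjoint_right.1 hs.disjoint_sep_right
  have key : ∀ u w : ((S : Set V)ᶜ : Set V), (G.induce (S : Set V)ᶜ).Walk u w →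
      u.1 ∈ A → w.1 ∈ A := by
    intro u w p
    induction p with
    | nil => exact id
    | @cons u v w huv _ ih =>
      intro hu
      refine ih ?_
      have hm := (hs.mem_iff v.1).2 (by simp)
      have hvS : v.1 ∉ S := fun hv => v.2 (by simpa using hv)
      have hvB : v.1 ∉ B := fun hv => hs.not_adj _ hu _ hv huv
      tauto
  obtain ⟨p⟩ := hc.preconnected ⟨a, by simpa using h1 ha⟩ ⟨b, by simpa using h3 hb⟩
  exact h2 (key _ _ p ha) hb

variable [Fintype V]

theorem SeparatorsLarge.kConnected_induce {D : Finset V} {W : Set V} (hW : ∀ v, v ∈ W ↔ v ∉ D)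
    (hcard : k + 1 ≤ Nat.card W) (h : SeparatorsLarge G k D) : KConnected (G.induce W) k := by
  classical
  refine ⟨hcard, fun T hT => ?_⟩
  let H := (G.induce W).induce Tᶜ
  have hne : Nonempty (Tᶜ : Set W) := by
    by_contra hemp
    have : T = Set.univ := by
      rw [Set.nonempty_coe_sort, Set.not_nonempty_iff_eq_empty, Set.compl_empty_iff] at hemp
      exact hemp
    rw [this, Set.ncard_univ] at hT
    omega
  refine (SimpleGraph.connected_iff _).2 ⟨fun a b => ?_, hne⟩
  by_contra hab
  let P : V → Prop := fun v => ∃ (hw : v ∈ W) (ht : ⟨v, hw⟩ ∈ Tᶜ), H.Reachable a ⟨⟨v, hw⟩, ht⟩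
  let Q : V → Prop := fun v => ∃ hw : v ∈ W, (⟨v, hw⟩ : W) ∈ T
  have hPW : ∀ v, P v → v ∈ W := fun v hv => hv.1
  have hQW : ∀ v, Q v → v ∈ W := fun v hv => hv.1
  have hPQ : ∀ v, P v → ¬ Q v := fun v hv hq => hv.2.1 hq.2
  have hsep : IsSeparation_s8 G D (univ.filter P) (univ.filter Q)
      (univ.filter fun v => v ∈ W ∧ ¬ P v ∧ ¬ Q v) := by
    constructor
    · exact ⟨a.1.1, by simpa using ⟨a.1.2, a.2, SimpleGraph.Reachable.refl _⟩⟩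
    · refine ⟨b.1.1, ?_⟩
      simp only [mem_filter, mem_univ, true_and]
      exact ⟨b.1.2, fun hp => hab hp.2.2, fun hq => b.2 hq.2⟩
    · rw [Finset.disjoint_left]; simpa using hPQ
    · rw [Finset.disjoint_left]; intro v; simp only [mem_filter, mem_univ]
      exact fun hp hb => hb.2.2.1 hp.2
    · rw [Finset.disjoint_left]; intro v; simp only [mem_filter, mem_univ]; tauto
    · intro v
      have := hPW v; have := hQW v
      rw [← hW]
      simp only [mem_filter, mem_univ, true_and]
      tauto
    · intro u hu v hv huv
      simp only [mem_filter, mem_univ, true_and] at hu hv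
      obtain ⟨huW, huT, hr⟩ := hu
      obtain ⟨hvW, hvP, hvQ⟩ := hv
      have hvT : (⟨v, hvW⟩ : W) ∈ Tᶜ := fun hv => hvQ ⟨hvW, hv⟩
      refine hvP ⟨hvW, hvT, hr.trans (SimpleGraph.Adj.reachable ?_)⟩
      exact huv
  have hk := h _ _ _ hsep
  have : ((univ.filter Q : Finset V) : Set V) = Subtype.val '' T := by
    ext v; simp [Q]
  rw [← Set.ncard_coe_finset, this, Set.ncard_image_of_injective _ Subtype.val_injective] at hk
  omega

variable [DecidableEq V]

/-- If all fragments are larger than `k / 2`, then some vertex lies in no minimum separator. -/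
theorem SeparatorsLarge.exists_insert {D : Finset V} (h : SeparatorsLarge G k D)
    (hfrag : ∀ A S B, IsSeparation_s8 G D A S B → #S = k → k < 2 * #A) (hne : ∃ x, x ∉ D) :
    ∃ x, SeparatorsLarge G k (insert x D) := by
  classical
  by_cases hex : ∃ n A S B, IsSeparation_s8 G D A S B ∧ #S = k ∧ #A = n
  · obtain ⟨A, S, B, hs, hS, hA⟩ := Nat.find_spec hex
    have hmin : ∀ X Y Z, IsSeparation_s8 G D X Y Z → #Y = k → #A ≤ #X := fun X Y Z hX hY =>
      hA ▸ Nat.find_min' hex ⟨X, Y, Z, hX, hY, rfl⟩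
    obtain ⟨a, ha⟩ := hs.left_nonempty
    refine ⟨a, h.insert_vertex ((hs.mem_iff a).1 (.inl ha)) fun X Y Z hX hY => ?_⟩
    exact Finset.disjoint_left.1
      (hs.disjoint_of_minimal h hS hmin (hfrag _ _ _ hs hS) hX hY) ha
  · obtain ⟨x, hx⟩ := hne
    exact ⟨x, h.insert_vertex hx fun A S B hs hS => (hex ⟨_, A, S, B, hs, hS, rfl⟩).elim⟩

theorem SeparatorsLarge.exists_adj [DecidableRel G.Adj] (h : SeparatorsLarge G k ∅)
    (hdeg : 3 * k / 2 + 2 ≤ G.minDegree) :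
    ∃ x y, G.Adj x y ∧ SeparatorsLarge G k {y, x} := by
  classical
  have hfrag : ∀ A S B, IsSeparation_s8 G ∅ A S B → #S = k → k < 2 * #A ∧ 2 ≤ #A := by
    intro A S B hs hS
    have := hs.minDegree_lt
    rw [card_empty] at this
    omega
  have hfrag' : ∀ x A S B, IsSeparation_s8 G {x} A S B → #S = k → k < 2 * #A := by
    intro x A S B hs hS
    have := hs.minDegree_lt
    rw [card_singleton] at this
    omega
  have hV : Nonempty V := by
    by_contra hV
    rw [not_nonempty_iff] at hV
    have := G.minDegree_of_subsingleton
    omega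
  obtain ⟨x₀, hx₀⟩ := h.exists_insert (fun A S B hs hS => (hfrag A S B hs hS).1)
    ⟨Classical.arbitrary V, by simp⟩
  rw [insert_empty_eq] at hx₀
  by_cases hex : ∃ n x A S B,
      SeparatorsLarge G k {x} ∧ IsSeparation_s8 G {x} A S B ∧ #S = k ∧ #A = n
  · obtain ⟨x, A, S, B, hx, hs, hS, hA⟩ := Nat.find_spec hex
    have hmin : ∀ x X Y Z, SeparatorsLarge G k {x} → IsSeparation_s8 G {x} X Y Z → #Y = k →
        #A ≤ #X := fun x X Y Z hx hX hY =>
      hA ▸ Nat.find_min' hex ⟨x, X, Y, Z, hx, hX, hY, rfl⟩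
    by_cases hadj : ∃ y ∈ A, G.Adj x y
    · obtain ⟨y, hy, hxy⟩ := hadj
      refine ⟨x, y, hxy, hx.insert_vertex (by simpa using hxy.ne') fun X Y Z hX hY => ?_⟩
      exact Finset.disjoint_left.1 (hs.disjoint_of_minimal hx hS
        (fun X Y Z => hmin x X Y Z hx) (hfrag' _ _ _ _ hs hS) hX hY) hy
    · push Not at hadj
      -- Then `A` is also a smallest fragment of `G`, and deleting one of its vertices
      -- yields a smaller one.
      have hs' : IsSeparation_s8 G ∅ A S (insert x B) :=
        IsSeparation_s8.insert_right (by simpa using hs) (by simp) hadj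
      have hmin' : ∀ X Y Z, IsSeparation_s8 G ∅ X Y Z → #Y = k → #A ≤ #X := by
        intro X Y Z hX hY
        rcases (hX.mem_iff x).2 (by simp) with hxX | hxY | hxZ
        · have h1 := (hX.symm.erase_right hxX (hfrag _ _ _ hX hY).2).symm
          rw [insert_empty_eq] at h1
          exact (hmin x _ _ _ hx h1 hY).trans (card_le_card (erase_subset _ _))
        · have h1 := hX.erase_sep hxY
          rw [insert_empty_eq] at h1
          have h2 := hx _ _ _ h1
          have h3 := card_erase_lt_of_mem hxY
          omega
        · have h1 := hX.erase_right hxZ (hfrag _ _ _ hX.symm hY).2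
          rw [insert_empty_eq] at h1
          exact hmin x _ _ _ hx h1 hY
      obtain ⟨z, hz⟩ := hs.left_nonempty
      have hzl : SeparatorsLarge G k (insert z ∅) := h.insert_vertex (by simp) fun X Y Z hX hY =>
        Finset.disjoint_left.1
          (hs'.disjoint_of_minimal h hS hmin' (hfrag _ _ _ hs' hS).1 hX hY) hz
      have hsz := (hs'.symm.erase_right hz (hfrag _ _ _ hs' hS).2).symm
      rw [insert_empty_eq] at hzl hsz
      have h1 := hmin z _ _ _ hzl hsz hS
      have h2 := card_erase_lt_of_mem hz
      omega
  · have hpos : 0 < G.degree x₀ := by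
      have := G.minDegree_le_degree x₀
      omega
    obtain ⟨y, hy⟩ := (G.degree_pos_iff_exists_adj x₀).1 hpos
    exact ⟨x₀, y, hy, hx₀.insert_vertex (by simpa using hy.ne') fun A S B hs hS =>
      (hex ⟨_, x₀, A, S, B, hx₀, hs, hS, rfl⟩).elim⟩

end

theorem connectivity_keeping_edge
    {V : Type} [Fintype V] (G : SimpleGraph V) [DecidableRel G.Adj]
    (k : ℕ) (hk : 1 ≤ k) (hGconn : KConnected G k)
    (hdeg : 3 * k / 2 + 2 ≤ G.minDegree) :
    ∃ u v : V, G.Adj u v ∧ KConnected (G.induce ({u, v} : Set V)ᶜ) k := by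
  classical
  obtain ⟨u, v, huv, hl⟩ := hGconn.separatorsLarge.exists_adj hdeg
  refine ⟨u, v, huv, hl.kConnected_induce (fun w => by simp [and_comm]) ?_⟩
  have h1 := G.minDegree_le_degree u
  have h2 := G.degree_lt_card_verts u
  have h3 := Set.ncard_add_ncard_compl ({u, v} : Set V)
  rw [Set.ncard_pair huv.ne, Nat.card_eq_fintype_card] at h3
  rw [Nat.card_coe_set_eq]
  omega
end

section
/- Let k and m be positive integers. Every k-connected bipartite finite simple graph G with minimum degree δ(G) ≥ k + m contains a path P of order m such that the graph G − V(P) obtained by deleting the vertices of P is still k-connected. -/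
open Finset

/-- `(Y, Z)` is a separation of `G[A]` with the clique on `C` added: there are no edges between
`Y` and `Z`, and `Y` avoids `C`. The part `Z` may be empty only if `C` is not. -/
structure IsSeparation_s11 {V : Type*} [DecidableEq V] (G : SimpleGraph V) (A C Y Z : Finset V) :
    Prop where
  left_subset : Y ⊆ A
  right_subset : Z ⊆ A
  disjoint : Disjoint Y Z
  not_adj : ∀ y ∈ Y, ∀ z ∈ Z, ¬ G.Adj y z
  left_nonempty : Y.Nonempty
  right_nonempty : Z.Nonempty ∨ C.Nonempty
  left_disjoint : Disjoint Y C

/-- Every separation of `G[A]` relative to `C` has order at least `k`. -/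
def ConnectedRel {V : Type*} [DecidableEq V] (G : SimpleGraph V) (k : ℕ) (A C : Finset V) : Prop :=
  ∀ Y Z, IsSeparation_s11 G A C Y Z → k ≤ #(A \ (Y ∪ Z))

section

variable {V : Type*} [DecidableEq V] {G : SimpleGraph V} {k : ℕ}

lemma IsSeparation_s11.sdiff_sdiff {A C X O : Finset V} (h : IsSeparation_s11 G A C X O) :
    (A \ O) \ (A \ (X ∪ O)) = X := by
  have := h.left_subset
  have := disjoint_left.1 h.disjoint
  grind

/-- In a triangle-free graph, a vertex set whose vertices have large degree and which has a
small boundary is large. -/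
lemma two_mul_le_card_add_card [DecidableRel G.Adj]
    (hG : ∀ u v w, G.Adj u v → G.Adj u w → ¬ G.Adj v w)
    {A X S : Finset V} {d : ℕ} (hX : X.Nonempty)
    (hN : ∀ x ∈ X, ∀ y ∈ A, G.Adj x y → y ∈ X ∪ S)
    (hd : ∀ x ∈ X, d ≤ #{y ∈ A | G.Adj x y}) (hS : #S < d) : 2 * d ≤ #X + #S := by
  obtain ⟨x, hx⟩ := hX
  obtain ⟨y, hy, hyS⟩ := exists_mem_notMem_of_card_lt_card (hS.trans_le (hd x hx))
  rw [mem_filter] at hy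
  have hyX : y ∈ X := (mem_union.1 (hN x hx y hy.1 hy.2)).resolve_right hyS
  have hdisj : Disjoint {w ∈ A | G.Adj x w} {w ∈ A | G.Adj y w} := by
    rw [disjoint_left]
    intro w hw hw'
    exact hG x y w hy.2 (mem_filter.1 hw).2 (mem_filter.1 hw').2
  have hsub : {w ∈ A | G.Adj x w} ∪ {w ∈ A | G.Adj y w} ⊆ X ∪ S := by
    intro w hw
    simp only [mem_union, mem_filter] at hw
    rcases hw with hw | hw
    · exact hN x hx w hw.1 hw.2
    · exact hN y hyX w hw.1 hw.2
  have h1 := card_le_card hsub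
  rw [card_union_of_disjoint hdisj] at h1
  have h2 := card_union_le X S
  have h3 := hd x hx
  have h4 := hd y hyX
  omega

/-- Uncrossing a separation `(X, O)` of order `k` with a pair `(U, W)` separated in `B \ P`. -/
lemma card_uncross_le {B X O P U W : Finset V}
    (hPX : P ⊆ X)
    (hS : #(B \ (X ∪ O)) = k) (hSn : (B \ (X ∪ O)).Nonempty)
    (hUB : U ⊆ B \ P) (hWB : W ⊆ B \ P) (hUW : Disjoint U W)
    (hadj : ∀ u ∈ U, ∀ w ∈ W, ¬ G.Adj u w) (hUX : (U ∩ X).Nonempty)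
    (hconn : ConnectedRel G k ((B \ O) \ P) (B \ (X ∪ O))) (hXO : Disjoint X O) :
    #(B \ ((X ∪ U) ∪ (W ∩ O))) ≤ #((B \ P) \ (U ∪ W)) := by
  have hF := hconn (U ∩ X) (W \ O)
    { left_subset := by grind [disjoint_left]
      right_subset := by grind
      disjoint := by grind [disjoint_left]
      not_adj := by grind
      left_nonempty := hUX
      right_nonempty := Or.inr hSn
      left_disjoint := by grind [disjoint_left] }
  have h1 := card_union_add_card_inter (B \ ((X ∪ U) ∪ (W ∩ O)))
    (((B \ O) \ P) \ ((U ∩ X) ∪ (W \ O)))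
  have h2 := card_union_add_card_inter ((B \ P) \ (U ∪ W)) (B \ (X ∪ O))
  rw [disjoint_left] at hUW hXO
  have h3 : (B \ ((X ∪ U) ∪ (W ∩ O))) ∪ (((B \ O) \ P) \ ((U ∩ X) ∪ (W \ O)))
      ⊆ ((B \ P) \ (U ∪ W)) ∪ (B \ (X ∪ O)) := by
    intro a; simp only [mem_union, mem_sdiff, mem_inter]; grind
  have h4 : (B \ ((X ∪ U) ∪ (W ∩ O))) ∩ (((B \ O) \ P) \ ((U ∩ X) ∪ (W \ O)))
      ⊆ ((B \ P) \ (U ∪ W)) ∩ (B \ (X ∪ O)) := by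
    intro a; simp only [mem_union, mem_sdiff, mem_inter]; grind
  have h5 := card_le_card h3
  have h6 := card_le_card h4
  omega

/-- If deleting `P` from one side `X` of a separation of order `k` keeps that side connected
relative to the separator, then it keeps the whole graph connected. -/
lemma ConnectedRel.sdiff [DecidableRel G.Adj] (hk : 1 ≤ k)
    (hG : ∀ u v w, G.Adj u v → G.Adj u w → ¬ G.Adj v w)
    {B C X O P : Finset V} (hB : ConnectedRel G k B C)
    (hXO : IsSeparation_s11 G B C X O) (hS : #(B \ (X ∪ O)) = k) (hPX : P ⊆ X) (hP : 1 ≤ #P)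
    (hdeg : ∀ v ∈ B \ C, k + #P ≤ #{w ∈ B | G.Adj v w})
    (hconn : ConnectedRel G k ((B \ O) \ P) (B \ (X ∪ O))) :
    ConnectedRel G k (B \ P) C := by
  intro Y Z hYZ
  by_contra! hT
  have hSn : (B \ (X ∪ O)).Nonempty := card_pos.1 (by omega)
  obtain ⟨hXB, hOB, hXOd, hXOadj, hXn, hXOn, hXC⟩ := hXO
  obtain ⟨hYB, hZB, hYZd, hYZadj, hYn, hYZn, hYC⟩ := hYZ
  have hXcard := two_mul_le_card_add_card hG (A := B) (X := X) (S := B \ (X ∪ O)) hXn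
    (by grind) (fun x hx => hdeg x (by grind [disjoint_left])) (by omega)
  have small {U : Finset V} (hUn : U.Nonempty) (hUS : U ⊆ B \ (X ∪ O)) (hUC : Disjoint U C)
      (hN : ∀ x ∈ U, ∀ y ∈ B, G.Adj x y → y ∈ U ∪ ((B \ P) \ (Y ∪ Z) ∪ P)) : False := by
    have h0 := card_union_le ((B \ P) \ (Y ∪ Z)) P
    have h1 := two_mul_le_card_add_card hG hUn hN
      (fun x hx => hdeg x (by grind [disjoint_left])) (by omega)
    have h2 := card_le_card hUS
    omega
  have coreY (h : (Y ∩ X).Nonempty) :=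
    card_uncross_le hPX hS hSn hYB hZB hYZd hYZadj h hconn hXOd
  have coreZ (h : (Z ∩ X).Nonempty) :=
    card_uncross_le hPX hS hSn hZB hYB hYZd.symm
      (fun u hu w hw hadj => hYZadj w hw u hu hadj.symm) h hconn hXOd
  rw [union_comm Z Y] at coreZ
  by_cases hYX : (Y ∩ X).Nonempty
  · have hR := coreY hYX
    have hno : ¬ ((Z ∩ O).Nonempty ∨ C.Nonempty) := by
      intro h
      have := hB (X ∪ Y) (Z ∩ O)
        { left_subset := by grind
          right_subset := by grind
          disjoint := by grind [disjoint_left]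
          not_adj := by grind
          left_nonempty := hXn.mono subset_union_left
          right_nonempty := h
          left_disjoint := by grind [disjoint_left] }
      omega
    push Not at hno
    obtain ⟨hZO, rfl⟩ := hno
    have hZn : Z.Nonempty := by simpa using hYZn
    have hOn : O.Nonempty := by simpa using hXOn
    by_cases hZX : (Z ∩ X).Nonempty
    · have hR' := coreZ hZX
      have hYO : ¬ (Y ∩ O).Nonempty := by
        intro h
        have := hB (X ∪ Z) (Y ∩ O)
          { left_subset := by grind
            right_subset := by grind
            disjoint := by grind [disjoint_left]
            not_adj := by grind [G.adj_comm]
            left_nonempty := hXn.mono subset_union_left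
            right_nonempty := Or.inl h
            left_disjoint := by simp }
        omega
      rw [not_nonempty_iff_eq_empty] at hYO
      have hOcard := two_mul_le_card_add_card hG (A := B) (X := O) (S := B \ (X ∪ O)) hOn
        (by grind [G.adj_comm]) (fun x hx => hdeg x (by grind)) (by omega)
      have hOT : O ⊆ (B \ P) \ (Y ∪ Z) := by
        intro a ha
        have h1 : a ∉ Y ∩ O := by simp [hYO]
        have h2 : a ∉ Z ∩ O := by simp [hZO]
        grind [disjoint_left]
      have := card_le_card hOT
      omega
    · rw [not_nonempty_iff_eq_empty] at hZX
      refine small hZn ?_ (by simp) ?_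
      · intro a ha
        have h1 : a ∉ Z ∩ X := by simp [hZX]
        have h2 : a ∉ Z ∩ O := by simp [hZO]
        grind
      · grind [G.adj_comm]
  · rw [not_nonempty_iff_eq_empty] at hYX
    have hZX : (Z ∩ X).Nonempty := by
      by_contra hZX
      rw [not_nonempty_iff_eq_empty] at hZX
      have hXT : X ⊆ ((B \ P) \ (Y ∪ Z)) ∪ P := by
        intro a ha
        have h1 : a ∉ Z ∩ X := by simp [hZX]
        have h2 : a ∉ Y ∩ X := by simp [hYX]
        grind
      have h1 := card_le_card hXT
      have h2 := card_union_le ((B \ P) \ (Y ∪ Z)) P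
      omega
    have hR := coreZ hZX
    have hYO : ¬ (Y ∩ O).Nonempty := by
      intro h
      have := hB (Y ∩ O) (X ∪ Z)
        { left_subset := by grind
          right_subset := by grind
          disjoint := by grind [disjoint_left]
          not_adj := by grind [G.adj_comm]
          left_nonempty := h
          right_nonempty := Or.inl (hXn.mono subset_union_left)
          left_disjoint := by grind [disjoint_left] }
      rw [union_comm (Y ∩ O)] at this
      omega
    rw [not_nonempty_iff_eq_empty] at hYO
    refine small hYn ?_ hYC ?_
    · intro a ha
      have h1 : a ∉ Y ∩ X := by simp [hYX]
      have h2 : a ∉ Y ∩ O := by simp [hYO]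
      grind
    · grind

/-- `ConnectedRel G k A C`, where moreover only `A \ C` may be cut off by exactly `k` vertices. -/
def StrictlyConnectedRel (G : SimpleGraph V) (k : ℕ) (A C : Finset V) : Prop :=
  ∀ Y Z, IsSeparation_s11 G A C Y Z →
    k ≤ #(A \ (Y ∪ Z)) ∧ (Y ≠ A \ C → k + 1 ≤ #(A \ (Y ∪ Z)))

/-- There is a path of order `m` from `z` inside `A \ C` whose deletion keeps `G[A]` connected
relative to `C`. -/
def HasKeepingPath (G : SimpleGraph V) (k m : ℕ) (A C : Finset V) (z : V) : Prop :=
  ∃ (v : V) (P : G.Walk z v), P.IsPath ∧ P.support.length = m ∧ P.support.toFinset ⊆ A \ C ∧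
    ConnectedRel G k (A \ P.support.toFinset) C

lemma StrictlyConnectedRel.erase {A C : Finset V} (h : StrictlyConnectedRel G k A C) {z : V}
    (hz : z ∈ A \ C) : ConnectedRel G k (A \ {z}) C := by
  intro Y Z hYZ
  obtain ⟨hYA, hZA, hd, hadj, hYn, hZn, hYC⟩ := hYZ
  have h1 := (h Y Z ⟨by grind, by grind, hd, hadj, hYn, hZn, hYC⟩).2 (by grind)
  have h2 : (A \ {z}) \ (Y ∪ Z) = (A \ (Y ∪ Z)).erase z := by grind
  rw [h2, card_erase_of_mem (by grind)]
  omega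

/-- The smaller side of a minimal separation of order `k` is strictly connected relative to the
separator. -/
lemma ConnectedRel.strictlyConnectedRel_of_minimal {A C X O : Finset V}
    (h : ConnectedRel G k A C) (hXO : IsSeparation_s11 G A C X O)
    (hmin : ∀ Y Z, IsSeparation_s11 G A C Y Z → #(A \ (Y ∪ Z)) = k → #X ≤ #Y) :
    StrictlyConnectedRel G k (A \ O) (A \ (X ∪ O)) := by
  intro Y Z hYZ
  have hX := hXO.sdiff_sdiff
  obtain ⟨hXA, hOA, hXOd, hXOadj, hXn, hXOn, hXC⟩ := hXO
  obtain ⟨hYA, hZA, hd, hadj, hYn, hZn, hYC⟩ := hYZ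
  have hYX : Y ⊆ X := by grind [disjoint_left]
  have hsep : IsSeparation_s11 G A C Y (Z ∪ O) :=
    { left_subset := by grind
      right_subset := by grind
      disjoint := by grind [disjoint_left]
      not_adj := by grind
      left_nonempty := hYn
      right_nonempty := hXOn.imp_left fun h => h.mono subset_union_right
      left_disjoint := hXC.mono_left hYX }
  have heq : A \ (Y ∪ (Z ∪ O)) = (A \ O) \ (Y ∪ Z) := by grind
  have h1 := h _ _ hsep
  have h2 := hmin _ _ hsep
  rw [heq] at h1 h2
  refine ⟨h1, fun hne => ?_⟩
  by_contra! hlt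
  have h3 := eq_of_subset_of_card_le hYX (h2 (by omega))
  exact hne (h3.trans hX.symm)

/-- Extends keeping paths from strictly connected pairs to connected ones, with a starting vertex
in a set `N` that meets every side of a separation of order `k`. -/
lemma ConnectedRel.exists_hasKeepingPath [DecidableRel G.Adj] {m : ℕ} (hk : 1 ≤ k) (hm : 1 ≤ m)
    (hG : ∀ u v w, G.Adj u v → G.Adj u w → ¬ G.Adj v w)
    (ih : ∀ A C : Finset V, C ⊆ A → (C = ∅ ∨ #C = k) → StrictlyConnectedRel G k A C →
      (∀ v ∈ A \ C, k + m ≤ #{w ∈ A | G.Adj v w}) → ∀ z ∈ A \ C, HasKeepingPath G k m A C z)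
    {A C : Finset V} (hA : ConnectedRel G k A C) (hCA : C ⊆ A) (hC : C = ∅ ∨ #C = k)
    (hdeg : ∀ v ∈ A \ C, k + m ≤ #{w ∈ A | G.Adj v w}) (N : Set V)
    (hN : ∀ X O, IsSeparation_s11 G A C X O → #(A \ (X ∪ O)) = k → ∃ x ∈ X, x ∈ N)
    (hN' : ∃ x ∈ A \ C, x ∈ N) : ∃ z ∈ N, HasKeepingPath G k m A C z := by
  by_cases hex : ∃ X O, IsSeparation_s11 G A C X O ∧ #(A \ (X ∪ O)) = k
  · obtain ⟨X, ⟨O, hXO, hS⟩, hmin⟩ := exists_minimalFor_of_wellFoundedLT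
      (fun X => ∃ O, IsSeparation_s11 G A C X O ∧ #(A \ (X ∪ O)) = k) card hex
    have hmin' : ∀ Y Z, IsSeparation_s11 G A C Y Z → #(A \ (Y ∪ Z)) = k → #X ≤ #Y := by
      intro Y Z hYZ hc
      by_contra! hlt
      exact absurd (hmin ⟨Z, hYZ, hc⟩ hlt.le) (by simpa using hlt)
    obtain ⟨z, hzX, hzN⟩ := hN X O hXO hS
    have hX := hXO.sdiff_sdiff
    obtain ⟨v, P, hP, hPm, hPX, hPc⟩ := ih (A \ O) (A \ (X ∪ O)) (by grind) (Or.inr hS)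
      (hA.strictlyConnectedRel_of_minimal hXO hmin') (by
        rw [hX]
        intro x hx
        have hxA := hXO.left_subset hx
        have hxC := disjoint_left.1 hXO.left_disjoint hx
        refine (hdeg x (mem_sdiff.2 ⟨hxA, hxC⟩)).trans (card_le_card ?_)
        intro w hw
        have := hXO.not_adj x hx w
        grind) z (by rwa [hX])
    rw [hX] at hPX
    have hcard : #P.support.toFinset = m := by
      rw [List.toFinset_card_of_nodup hP.support_nodup, hPm]
    refine ⟨z, hzN, v, P, hP, hPm, ?_, ?_⟩
    · intro a ha
      exact mem_sdiff.2 ⟨hXO.left_subset (hPX ha), disjoint_left.1 hXO.left_disjoint (hPX ha)⟩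
    · exact hA.sdiff hk hG hXO hS hPX (by omega) (by rwa [hcard]) hPc
  · push Not at hex
    obtain ⟨z, hz, hzN⟩ := hN'
    refine ⟨z, hzN, ih A C hCA hC (fun Y Z hYZ => ?_) hdeg z hz⟩
    have h1 := hA Y Z hYZ
    have h2 := hex Y Z hYZ
    omega

/-- In a triangle-free graph of large minimum degree, every vertex starts a keeping path. -/
lemma StrictlyConnectedRel.hasKeepingPath [DecidableRel G.Adj] {m : ℕ} (hk : 1 ≤ k) (hm : 1 ≤ m)
    (hG : ∀ u v w, G.Adj u v → G.Adj u w → ¬ G.Adj v w) :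
    ∀ A C : Finset V, C ⊆ A → (C = ∅ ∨ #C = k) → StrictlyConnectedRel G k A C →
      (∀ v ∈ A \ C, k + m ≤ #{w ∈ A | G.Adj v w}) →
      ∀ z ∈ A \ C, HasKeepingPath G k m A C z := by
  induction m, hm using Nat.le_induction with
  | base =>
    intro A C _ _ hA _ z hz
    exact ⟨z, .nil, by simp, by simp, by simpa using hz, by simpa using hA.erase hz⟩
  | succ m hm ih =>
    intro A C hCA hC hA hdeg z hz
    have hzA : z ∈ A ∧ z ∉ C := mem_sdiff.1 hz
    have hdeg' : ∀ v ∈ (A \ {z}) \ C, k + m ≤ #{w ∈ A \ {z} | G.Adj v w} := by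
      intro v hv
      have h1 := hdeg v (by grind)
      have h2 : ({w ∈ A | G.Adj v w} : Finset V).erase z ⊆ {w ∈ A \ {z} | G.Adj v w} := by grind
      have h3 := card_le_card h2
      have h4 := pred_card_le_card_erase (s := {w ∈ A | G.Adj v w}) (a := z)
      omega
    obtain ⟨y, hy, v, P, hP, hPm, hPA, hPc⟩ :=
      (hA.erase hz).exists_hasKeepingPath hk hm hG ih (by grind) hC hdeg' {y | G.Adj z y}
        (by
          intro X O hXO hS
          by_contra! hno
          obtain ⟨hXA, hOA, hd, hadj, hXn, hOn, hXC⟩ := hXO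
          have h1 := (hA X (insert z O)
            { left_subset := by grind
              right_subset := by grind
              disjoint := by grind [disjoint_left]
              not_adj := by
                intro x hx o ho
                rcases mem_insert.1 ho with rfl | ho
                · exact fun h => hno x hx h.symm
                · exact hadj x hx o ho
              left_nonempty := hXn
              right_nonempty := Or.inl (insert_nonempty _ _)
              left_disjoint := hXC }).2 (by grind)
          have h2 : A \ (X ∪ insert z O) = (A \ {z}) \ (X ∪ O) := by grind
          rw [h2] at h1
          omega)
        (by
          have h1 := hdeg z hz
          have h2 : #C ≤ k := by rcases hC with rfl | h <;> simp_all
          obtain ⟨y, hy, hyC⟩ := exists_mem_notMem_of_card_lt_card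
            (show #C < #{w ∈ A | G.Adj z w} by omega)
          rw [mem_filter] at hy
          have := hy.2.ne
          exact ⟨y, by grind, hy.2⟩)
    have hzP : z ∉ P.support := fun h => by
      have := hPA (List.mem_toFinset.2 h)
      grind
    refine ⟨v, .cons hy P, hP.cons hzP, by simpa using hPm, ?_, ?_⟩
    · intro a ha
      have := @hPA a
      simp only [SimpleGraph.Walk.support_cons, List.toFinset_cons, mem_insert] at ha
      grind
    · have : A \ (SimpleGraph.Walk.cons hy P).support.toFinset
          = (A \ {z}) \ P.support.toFinset := by
        simp only [SimpleGraph.Walk.support_cons, List.toFinset_cons]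
        grind
      rwa [this]

end

lemma KConnected.connectedRel {V : Type*} [Fintype V] [DecidableEq V] {G : SimpleGraph V} {k : ℕ}
    (h : KConnected G k) : ConnectedRel G k univ ∅ := by
  intro Y Z hYZ
  by_contra! hlt
  have hconn := h.2 (↑(univ \ (Y ∪ Z)) : Set V) (by rwa [Set.ncard_coe_finset])
  obtain ⟨y, hy⟩ := hYZ.left_nonempty
  obtain ⟨z, hz⟩ : Z.Nonempty := by simpa using hYZ.right_nonempty
  obtain ⟨p⟩ := hconn.preconnected ⟨y, by simp [hy]⟩ ⟨z, by simp [hz]⟩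
  obtain ⟨d, -, hd1, hd2⟩ := p.exists_boundary_dart {x | x.1 ∈ Y} hy
    (fun h => disjoint_left.1 hYZ.disjoint h hz)
  have h3 := d.snd.2
  simp only [coe_sdiff, coe_univ, Set.mem_compl_iff, Set.mem_sdiff, Set.mem_univ, true_and,
    mem_coe, not_not, mem_union] at h3
  exact hYZ.not_adj _ hd1 _ (h3.resolve_left hd2) d.adj

lemma ConnectedRel.kConnected {V : Type*} [Fintype V] [DecidableEq V] {G : SimpleGraph V} {k : ℕ}
    {s : Set V} {A : Finset V} (hs : s = A) (hA : k + 1 ≤ #A) (h : ConnectedRel G k A ∅) :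
    KConnected (G.induce s) k := by
  classical
  subst hs
  have hcard : Nat.card (A : Set V) = #A := by simp
  refine ⟨hcard ▸ hA, fun S hS => ?_⟩
  rw [SimpleGraph.connected_iff]
  constructor
  · intro u v
    by_contra huv
    let Y : Finset V := {x | ∃ a : (Sᶜ : Set (A : Set V)), a.1.1 = x ∧
      ((G.induce (A : Set V)).induce Sᶜ).Reachable u a}
    let Z : Finset V := {x | ∃ a : (Sᶜ : Set (A : Set V)), a.1.1 = x ∧
      ¬ ((G.induce (A : Set V)).induce Sᶜ).Reachable u a}
    have hk := h Y Z
      { left_subset := by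
          intro x hx
          obtain ⟨a, rfl, -⟩ := (mem_filter.1 hx).2
          exact a.1.2
        right_subset := by
          intro x hx
          obtain ⟨a, rfl, -⟩ := (mem_filter.1 hx).2
          exact a.1.2
        disjoint := by
          rw [disjoint_left]
          intro x hx hx'
          obtain ⟨a, rfl, ha⟩ := (mem_filter.1 hx).2
          obtain ⟨b, hb, hb'⟩ := (mem_filter.1 hx').2
          exact hb' (by rwa [Subtype.ext (Subtype.ext hb)])
        not_adj := by
          intro x hx y hy hxy
          obtain ⟨a, rfl, ha⟩ := (mem_filter.1 hx).2
          obtain ⟨b, rfl, hb⟩ := (mem_filter.1 hy).2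
          exact hb (ha.trans (SimpleGraph.Adj.reachable hxy))
        left_nonempty := ⟨u.1.1, mem_filter.2 ⟨mem_univ _, u, rfl, .refl _⟩⟩
        right_nonempty := Or.inl ⟨v.1.1, mem_filter.2 ⟨mem_univ _, v, rfl, huv⟩⟩
        left_disjoint := by simp }
    have hsub : ((A \ (Y ∪ Z) : Finset V) : Set V) ⊆ Subtype.val '' S := by
      intro x hx
      simp only [coe_sdiff, coe_union, Set.mem_sdiff, mem_coe, Set.mem_union, not_or] at hx
      by_contra hxS
      have hxS' : (⟨x, hx.1⟩ : (A : Set V)) ∈ Sᶜ := fun hS => hxS ⟨_, hS, rfl⟩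
      by_cases hr : ((G.induce (A : Set V)).induce Sᶜ).Reachable u ⟨⟨x, hx.1⟩, hxS'⟩
      · exact hx.2.1 (mem_filter.2 ⟨mem_univ _, _, rfl, hr⟩)
      · exact hx.2.2 (mem_filter.2 ⟨mem_univ _, _, rfl, hr⟩)
    have h1 := Set.ncard_le_ncard hsub (Set.toFinite _)
    rw [Set.ncard_coe_finset, Set.ncard_image_of_injective _ Subtype.val_injective] at h1
    omega
  · by_contra hne
    have hS' : S = Set.univ := by
      rw [not_nonempty_iff, Set.isEmpty_coe_sort] at hne
      exact Set.compl_empty_iff.1 hne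
    rw [hS', Set.ncard_univ, hcard] at hS
    omega

lemma SimpleGraph.Colorable.not_adj_of_adj_of_adj {V : Type*} {G : SimpleGraph V}
    (h : G.Colorable 2) (u v w : V) (huv : G.Adj u v) (huw : G.Adj u w) : ¬ G.Adj v w := by
  obtain ⟨c⟩ := h
  intro hvw
  have h1 := c.valid huv
  have h2 := c.valid huw
  have h3 := c.valid hvw
  omega

theorem connectivity_keeping_path_bipartite
    {V : Type} [Fintype V] (G : SimpleGraph V) [DecidableRel G.Adj]
    (k m : ℕ) (hk : 1 ≤ k) (hm : 1 ≤ m)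
    (hGconn : KConnected G k) (hGbip : G.Colorable 2)
    (hdeg : k + m ≤ G.minDegree) :
    ∃ (u v : V) (P : G.Walk u v), P.IsPath ∧ P.support.length = m ∧
      KConnected (G.induce {x | x ∈ P.support}ᶜ) k := by
  classical
  have hG := hGbip.not_adj_of_adj_of_adj
  have hV : Nonempty V := by
    by_contra hV
    rw [not_nonempty_iff] at hV
    have := hGconn.1
    simp at this
  have hdeg' : ∀ v, k + m ≤ G.degree v := fun v => hdeg.trans (G.minDegree_le_degree v)
  obtain ⟨z, -, v, P, hP, hPm, -, hPc⟩ :=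
    hGconn.connectedRel.exists_hasKeepingPath hk hm hG
      (StrictlyConnectedRel.hasKeepingPath hk hm hG) (empty_subset _) (Or.inl rfl)
      (fun v _ => by
        rw [← G.neighborFinset_eq_filter, G.card_neighborFinset_eq_degree]
        exact hdeg' v)
      Set.univ (fun X O hXO _ => hXO.left_nonempty.imp fun x hx => ⟨hx, trivial⟩)
      ⟨Classical.arbitrary V, by simp⟩
  refine ⟨z, v, P, hP, hPm, hPc.kConnected (by ext; simp) ?_⟩
  have h1 := (hdeg' z).trans_lt (G.degree_lt_card_verts z)
  rw [card_sdiff_of_subset (subset_univ _), List.toFinset_card_of_nodup hP.support_nodup, hPm,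
    card_univ]
  omega
end

section
/- Let k and m be positive integers. Every k-connected triangle-free finite simple graph G with minimum degree δ(G) ≥ k + ⌈(m+1)/2⌉ contains a path P of order m such that the graph G − V(P) obtained by deleting the vertices of P is still k-connected. -/
open Finset

namespace SimpleGraph

variable {V : Type*} [Fintype V] [DecidableEq V] (G : SimpleGraph V) [DecidableRel G.Adj]

/-- The neighbourhood of `B` in `G - X`. -/
def boundary (X B : Finset V) : Finset V :=
  univ.filter fun w => w ∉ X ∧ w ∉ B ∧ ∃ d ∈ B, G.Adj d w

/-- `B` is a nonempty set of vertices of `G - X` whose closed neighbourhood in `G - X` is not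
everything. -/
def Separated (X B : Finset V) : Prop :=
  B.Nonempty ∧ Disjoint B X ∧ ∃ w, w ∉ X ∧ w ∉ B ∧ w ∉ G.boundary X B

/-- `B` is a union of components, but not of all of them, of `G - X` minus at most `k` vertices. -/
def IsFragment (k : ℕ) (X B : Finset V) : Prop :=
  G.Separated X B ∧ #(G.boundary X B) ≤ k

/-- No set of fewer than `k` vertices separates `G - X`. -/
def SeparatorBound (k : ℕ) (X : Finset V) : Prop :=
  ∀ B, G.Separated X B → k ≤ #(G.boundary X B)

/-- `A` contains no smaller fragment of `G - X`, and is itself a fragment or all of `G - X`. -/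
def IsAtomic (k : ℕ) (X A : Finset V) : Prop :=
  (G.IsFragment k X A ∨ A = Xᶜ) ∧ ∀ B ⊂ A, ¬ G.IsFragment k X B

variable {G} {k : ℕ} {X A B Z : Finset V}

lemma mem_boundary {w : V} :
    w ∈ G.boundary X B ↔ w ∉ X ∧ w ∉ B ∧ ∃ d ∈ B, G.Adj d w := by
  simp [boundary]

/-- A nonempty set whose neighbourhood avoids some vertex of `G - X` is separated. -/
lemma separated_of_boundary_subset {w : V} (hB : B.Nonempty) (hBX : Disjoint B X)
    (hZ : G.boundary X B ⊆ Z) (hwX : w ∉ X) (hwB : w ∉ B) (hwZ : w ∉ Z) : G.Separated X B :=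
  ⟨hB, hBX, w, hwX, hwB, fun h => hwZ (hZ h)⟩

lemma disjoint_neighborFinset_of_adj (htf : G.CliqueFree 3) {x y : V} (h : G.Adj x y) :
    Disjoint (G.neighborFinset x) (G.neighborFinset y) := by
  rw [Finset.disjoint_left]
  intro w hx hy
  rw [mem_neighborFinset] at hx hy
  exact htf {x, y, w} (is3Clique_triple_iff.2 ⟨h, hx, hy⟩)

/-- In a triangle-free graph with large degrees, a set with few neighbours is large. -/
lemma card_lower_bound_of_boundary_subset (htf : G.CliqueFree 3)
    (hdeg : ∀ v ∉ X, k + 1 ≤ #(G.neighborFinset v \ X))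
    (hB : B.Nonempty) (hBX : Disjoint B X) (hZ : G.boundary X B ⊆ Z) (hZk : #Z ≤ k) :
    k + 2 ≤ #B := by
  have hsub : ∀ x ∈ B, G.neighborFinset x \ X ⊆ B ∪ Z := by
    intro x hx w hw
    rw [mem_sdiff, mem_neighborFinset] at hw
    by_cases hwB : w ∈ B
    · exact mem_union_left _ hwB
    · exact mem_union_right _ (hZ (mem_boundary.2 ⟨hw.2, hwB, x, hx, hw.1⟩))
  obtain ⟨x, hx⟩ := hB
  have hxd := hdeg x (Finset.disjoint_left.1 hBX hx)
  obtain ⟨y, hy, hyZ⟩ : ∃ y ∈ G.neighborFinset x \ X, y ∉ Z :=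
    exists_mem_notMem_of_card_lt_card (by omega)
  have hyB : y ∈ B := (mem_union.1 (hsub x hx hy)).resolve_right hyZ
  have hyd := hdeg y (mem_sdiff.1 hy).2
  have hdisj : Disjoint (G.neighborFinset x \ X) (G.neighborFinset y \ X) :=
    (disjoint_neighborFinset_of_adj htf ((mem_neighborFinset ..).1 (mem_sdiff.1 hy).1)).mono
      sdiff_subset sdiff_subset
  have hle := card_le_card (union_subset (hsub x hx) (hsub y hyB))
  rw [card_union_of_disjoint hdisj] at hle
  have := card_union_le B Z
  omega

lemma card_inter_add_card_inter_add_card_inter_le {α : Type*} [DecidableEq α]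
    {P Q R : Finset α} (S : Finset α) (hPQ : Disjoint P Q) (hPR : Disjoint P R)
    (hQR : Disjoint Q R) : #(S ∩ P) + #(S ∩ Q) + #(S ∩ R) ≤ #S := by
  rw [← card_union_of_disjoint (hPQ.mono inter_subset_right inter_subset_right),
    ← card_union_of_disjoint, ← inter_union_distrib_left, ← inter_union_distrib_left]
  · exact card_le_card inter_subset_left
  · rw [← inter_union_distrib_left]
    exact (disjoint_union_left.2 ⟨hPR, hQR⟩).mono inter_subset_right inter_subset_right

/-- The two opposite corners of a pair of crossing separations cannot both be nonempty when the
first corner has too many neighbours. -/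
lemma inter_eq_empty_of_crossing {A' D E S : Finset V} (hX : G.SeparatorBound k X)
    (hS : #S ≤ k) (hZ : #Z ≤ k) (hA'X : Disjoint A' X) (hADX : Disjoint (A ∩ D) X)
    (hAD : Disjoint A A') (hDE : Disjoint D E) (hAS : Disjoint A S) (hA'S : Disjoint A' S)
    (hDZ : Disjoint D Z) (hEZ : Disjoint E Z)
    (hbA : G.boundary X A ⊆ S) (hbA' : G.boundary X A' ⊆ S)
    (hbD : G.boundary X D ⊆ Z) (hbE : G.boundary X E ⊆ Z)
    (hmin : k < #(G.boundary X (A ∩ D))) (hne : (A ∩ D).Nonempty) : A' ∩ E = ∅ := by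
  by_contra hne'
  rw [← Ne, ← nonempty_iff_ne_empty] at hne'
  obtain ⟨w, hw⟩ := hne
  have hcorner : ∀ P Q : Finset V, G.boundary X P ⊆ S → G.boundary X Q ⊆ Z →
      G.boundary X (P ∩ Q) ⊆ (S ∩ Q) ∪ (S ∩ Z) ∪ (P ∩ Z) := by
    intro P Q hP hQ w hw
    obtain ⟨hwX, hwPQ, d, hd, hdw⟩ := mem_boundary.1 hw
    rw [mem_inter] at hd hwPQ
    have h1 : w ∉ P → w ∈ S := fun h => hP (mem_boundary.2 ⟨hwX, h, d, hd.1, hdw⟩)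
    have h2 : w ∉ Q → w ∈ Z := fun h => hQ (mem_boundary.2 ⟨hwX, h, d, hd.2, hdw⟩)
    simp only [mem_union, mem_inter]
    tauto
  have h1 := card_le_card (hcorner A D hbA hbD)
  have h2 := card_le_card (hcorner A' E hbA' hbE)
  have hsep : k ≤ #(G.boundary X (A' ∩ E)) := by
    refine hX _ ⟨hne', hA'X.mono_left inter_subset_left, w, ?_, ?_, fun hwb => ?_⟩
    · exact Finset.disjoint_left.1 hADX hw
    · exact fun h => Finset.disjoint_left.1 hAD (mem_inter.1 hw).1 (mem_inter.1 h).1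
    · have := hcorner A' E hbA' hbE hwb
      have hwA := (mem_inter.1 hw).1
      have hwD := (mem_inter.1 hw).2
      simp only [mem_union, mem_inter] at this
      rcases this with (h | h) | h
      · exact Finset.disjoint_left.1 hAS hwA h.1
      · exact Finset.disjoint_left.1 hAS hwA h.1
      · exact Finset.disjoint_left.1 hDZ hwD h.2
  have e1 := card_inter_add_card_inter_add_card_inter_le S hDE hDZ hEZ
  have e2 := card_inter_add_card_inter_add_card_inter_le Z hAD hAS hA'S
  rw [inter_comm Z A, inter_comm Z A', inter_comm Z S] at e2
  have u1 := card_union_le ((S ∩ D) ∪ (S ∩ Z)) (A ∩ Z)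
  have u2 := card_union_le (S ∩ D) (S ∩ Z)
  have u3 := card_union_le ((S ∩ E) ∪ (S ∩ Z)) (A' ∩ Z)
  have u4 := card_union_le (S ∩ E) (S ∩ Z)
  omega

/-- The vertices of `G - X` away from `B` and its neighbours form a set whose neighbours are
neighbours of `B`. -/
lemma boundary_compl_subset (hZ : G.boundary X B ⊆ Z) :
    G.boundary X (univ \ (X ∪ B ∪ Z)) ⊆ Z := by
  intro w hw
  obtain ⟨hwX, hwR, d, hd, hdw⟩ := mem_boundary.1 hw
  simp only [mem_sdiff, mem_univ, true_and, mem_union, not_or, not_and, not_not] at hwR hd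
  by_contra hwZ
  have hwB : w ∈ B := by tauto
  exact hd.2 (hZ (mem_boundary.2 ⟨hd.1.1, hd.1.2, w, hwB, hdw.symm⟩))

/-- Deleting a vertex of an atomic set keeps the graph free of separators of size below `k`. -/
lemma SeparatorBound.insert_of_mem_isAtomic (htf : G.CliqueFree 3)
    (hdeg : ∀ v ∉ X, k + 1 ≤ #(G.neighborFinset v \ X))
    (hX : G.SeparatorBound k X) (hA : G.IsAtomic k X A) {z : V} (hz : z ∈ A) :
    G.SeparatorBound k (insert z X) := by
  intro D hD
  by_contra! hlt
  obtain ⟨hDne, hDX, w, hwX, hwD, hwb⟩ := hD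
  set Z := insert z (G.boundary (insert z X) D) with hZdef
  have hzZ : z ∈ Z := mem_insert_self ..
  have hZk : #Z ≤ k := (card_insert_le ..).trans hlt
  have hbD : G.boundary X D ⊆ Z := by
    intro v hv
    obtain ⟨hvX, hvD, hd⟩ := mem_boundary.1 hv
    by_cases hvz : v = z
    · exact hvz ▸ hzZ
    · exact mem_insert_of_mem (mem_boundary.2 ⟨by simp [hvz, hvX], hvD, hd⟩)
  rw [mem_insert, not_or] at hwX
  have hDX' : Disjoint D X := hDX.mono_right (subset_insert ..)
  have hDZ : Disjoint D Z := by
    rw [Finset.disjoint_left] at hDX ⊢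
    intro v hv hvZ
    rcases mem_insert.1 hvZ with rfl | h
    · exact hDX hv (mem_insert_self ..)
    · exact (mem_boundary.1 h).2.1 hv
  have hwZ : w ∉ Z := by simp [hZdef, hwX.1, hwb]
  have hDsep : G.Separated X D :=
    separated_of_boundary_subset hDne hDX' hbD hwX.2 hwD hwZ
  have hDfrag : G.IsFragment k X D := ⟨hDsep, (card_le_card hbD).trans hZk⟩
  obtain ⟨hA1 | rfl, hA2⟩ := hA
  swap
  · refine hA2 D ⟨?_, fun h => ?_⟩ hDfrag
    · exact fun v hv => mem_compl.2 (Finset.disjoint_left.1 hDX' hv)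
    · exact Finset.disjoint_left.1 hDZ (h hz) hzZ
  obtain ⟨⟨hAne, hAX, a, haX, haA, haS⟩, hSk⟩ := hA1
  set S := G.boundary X A with hSdef
  set A' := univ \ (X ∪ A ∪ S) with hA'def
  set E := univ \ (X ∪ D ∪ Z) with hEdef
  have hbE : G.boundary X E ⊆ Z := boundary_compl_subset hbD
  have hbA' : G.boundary X A' ⊆ S := boundary_compl_subset subset_rfl
  have hA'ne : A'.Nonempty := ⟨a, by simp [hA'def, haX, haA, haS]⟩
  have hEne : E.Nonempty := ⟨w, by simp [hEdef, hwX, hwD, hwZ]⟩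
  have hA'X : Disjoint A' X := by rw [Finset.disjoint_left]; grind
  have hEX : Disjoint E X := by rw [Finset.disjoint_left]; grind
  have hAA' : Disjoint A A' := by rw [Finset.disjoint_left]; grind
  have hDE : Disjoint D E := by rw [Finset.disjoint_left]; grind
  have hA'S : Disjoint A' S := by rw [Finset.disjoint_left]; grind
  have hEZ : Disjoint E Z := by rw [Finset.disjoint_left]; grind
  have hAS : Disjoint A S :=
    Finset.disjoint_left.2 fun v hv hvS => (mem_boundary.1 hvS).2.1 hv
  have cA := card_lower_bound_of_boundary_subset htf hdeg hAne hAX subset_rfl hSk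
  have cA' := card_lower_bound_of_boundary_subset htf hdeg hA'ne hA'X hbA' hSk
  have cD := card_lower_bound_of_boundary_subset htf hdeg hDne hDX' hbD hZk
  have cE := card_lower_bound_of_boundary_subset htf hdeg hEne hEX hbE hZk
  have hmin : ∀ Q : Finset V, G.boundary X Q ⊆ Z → Disjoint Q Z → (A ∩ Q).Nonempty →
      k < #(G.boundary X (A ∩ Q)) := by
    intro Q hQ hQZ hne
    by_contra! hle
    refine hA2 (A ∩ Q) ⟨inter_subset_left, fun h => ?_⟩
      ⟨⟨hne, hAX.mono_left inter_subset_left, a, haX, ?_, ?_⟩, hle⟩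
    · exact Finset.disjoint_left.1 hQZ (mem_inter.1 (h hz)).2 hzZ
    · exact fun h => haA (mem_inter.1 h).1
    · intro h
      obtain ⟨-, -, d, hd, hda⟩ := mem_boundary.1 h
      exact haS (mem_boundary.2 ⟨haX, haA, d, (mem_inter.1 hd).1, hda⟩)
  have hcross : ∀ Q R : Finset V, G.boundary X Q ⊆ Z → G.boundary X R ⊆ Z → Disjoint Q Z →
      Disjoint R Z → Disjoint Q R → A ∩ Q = ∅ ∨ A' ∩ R = ∅ := by
    intro Q R hQ hR hQZ hRZ hQR
    rcases (A ∩ Q).eq_empty_or_nonempty with h | h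
    · exact Or.inl h
    · exact Or.inr (inter_eq_empty_of_crossing hX hSk hZk hA'X
        (hAX.mono_left inter_subset_left) hAA' hQR hAS hA'S hQZ hRZ subset_rfl hbA' hQ hR
        (hmin Q hQ hQZ h) h)
  have hcoverDE : ∀ v ∉ X, v ∉ D → v ∉ E → v ∈ Z := by grind
  have hcoverA : ∀ v ∉ X, v ∉ A → v ∉ A' → v ∈ S := by grind
  have hbig : ∀ P W : Finset V, k + 2 ≤ #P → #W ≤ k → ¬ P ⊆ W := by
    intro P W h1 h2 h
    have := card_le_card h
    omega
  simp only [Finset.disjoint_left] at hAX hA'X hDX' hEX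
  simp only [Finset.eq_empty_iff_forall_notMem, mem_inter, not_and] at hcross
  rcases hcross D E hbD hbE hDZ hEZ hDE with h1 | h1 <;>
    rcases hcross E D hbE hbD hEZ hDZ hDE.symm with h2 | h2
  · exact hbig A Z cA hZk fun v hv => hcoverDE v (hAX hv) (h1 v hv) (h2 v hv)
  · exact hbig D S cD hSk fun v hv =>
      hcoverA v (hDX' hv) (fun h => h1 v h hv) (fun h => h2 v h hv)
  · exact hbig E S cE hSk fun v hv =>
      hcoverA v (hEX hv) (fun h => h2 v h hv) (fun h => h1 v h hv)
  · exact hbig A' Z cA' hZk fun v hv => hcoverDE v (hA'X hv) (h2 v hv) (h1 v hv)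

/-- Every fragment contains an atomic one. -/
lemma IsFragment.exists_isAtomic {F : Finset V} (hF : G.IsFragment k X F) :
    ∃ A ⊆ F, G.IsFragment k X A ∧ G.IsAtomic k X A := by
  obtain ⟨A, hAF, hA⟩ := exists_minimal_le_of_wellFoundedLT (G.IsFragment k X) F hF
  exact ⟨A, hAF, hA.prop, Or.inl hA.prop, fun B hBA hB => hA.not_prop_of_lt hBA hB⟩

/-- `F` is a fragment of `G - X` or all of `G - X`, and `y` has neighbours in `F` and in every
fragment contained in `F`. -/
def Extendable (G : SimpleGraph V) [DecidableRel G.Adj] (k : ℕ) (X F : Finset V) (y : V) : Prop :=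
  (G.IsFragment k X F ∨ F = Xᶜ) ∧ (∃ z ∈ F, G.Adj y z) ∧
    ∀ B ⊆ F, G.IsFragment k X B → ∃ z ∈ B, G.Adj y z

lemma Extendable.exists_isAtomic {F : Finset V} {y : V} (h : G.Extendable k X F y) :
    ∃ A, G.IsAtomic k X A ∧ ∃ z ∈ A, G.Adj y z := by
  obtain ⟨hF, hz, hB⟩ := h
  by_cases hex : ∃ B ⊆ F, G.IsFragment k X B
  · obtain ⟨B, hBF, hBfrag⟩ := hex
    obtain ⟨A, hAB, hAfrag, hA⟩ := hBfrag.exists_isAtomic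
    exact ⟨A, hA, hB A (hAB.trans hBF) hAfrag⟩
  · push Not at hex
    exact ⟨F, ⟨hF, fun B hBF => hex B hBF.subset⟩, hz⟩

lemma exists_isAtomic_nonempty (hX : Xᶜ.Nonempty) : ∃ A, G.IsAtomic k X A ∧ A.Nonempty := by
  by_cases hex : ∃ B, G.IsFragment k X B
  · obtain ⟨B, hB⟩ := hex
    obtain ⟨A, -, hAfrag, hA⟩ := hB.exists_isAtomic
    exact ⟨A, hA, hAfrag.1.1⟩
  · push Not at hex
    exact ⟨Xᶜ, ⟨Or.inr rfl, fun B _ => hex B⟩, hX⟩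

lemma IsAtomic.disjoint (hA : G.IsAtomic k X A) : Disjoint A X := by
  rcases hA.1 with h | rfl
  · exact h.1.2.1
  · exact disjoint_compl_left

/-- After removing a vertex `z` of an atomic set `A`, the removed path can be continued from `z`
inside `A`. -/
lemma IsAtomic.extendable_erase (hdeg : ∀ v ∉ X, k + 1 ≤ #(G.neighborFinset v \ X))
    (hA : G.IsAtomic k X A) {z : V} (hz : z ∈ A) :
    G.Extendable k (insert z X) (A.erase z) z := by
  have hzX : z ∉ X := Finset.disjoint_left.1 hA.disjoint hz
  have hnbr : ∃ v ∈ A.erase z, G.Adj z v := by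
    have hbd : #(G.boundary X A) ≤ k := by
      rcases hA.1 with h | rfl
      · exact h.2
      · have : G.boundary X Xᶜ = ∅ := by
          ext v; simp [mem_boundary]; tauto
        simp [this]
    obtain ⟨v, hv, hvb⟩ : ∃ v ∈ G.neighborFinset z \ X, v ∉ G.boundary X A :=
      exists_mem_notMem_of_card_lt_card (by have := hdeg z hzX; omega)
    rw [mem_sdiff, mem_neighborFinset] at hv
    refine ⟨v, mem_erase.2 ⟨hv.1.ne', ?_⟩, hv.1⟩
    by_contra hvA
    exact hvb (mem_boundary.2 ⟨hv.2, hvA, z, hz, hv.1⟩)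
  refine ⟨?_, hnbr, ?_⟩
  · rcases hA.1 with h | rfl
    · left
      have hsub : G.boundary (insert z X) (A.erase z) ⊆ G.boundary X A := by
        intro v hv
        obtain ⟨hvX, hvA, d, hd, hdv⟩ := mem_boundary.1 hv
        rw [mem_insert, not_or] at hvX
        exact mem_boundary.2
          ⟨hvX.2, fun h => hvA (mem_erase.2 ⟨hvX.1, h⟩), d, mem_of_mem_erase hd, hdv⟩
      obtain ⟨⟨-, hAX, w, hwX, hwA, hwb⟩, hcard⟩ := h
      refine ⟨⟨hnbr.imp fun _ h => h.1, ?_, w, ?_, ?_, fun h => hwb (hsub h)⟩,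
        (card_le_card hsub).trans hcard⟩
      · rw [Finset.disjoint_left] at hAX ⊢
        grind
      · grind
      · grind
    · right
      ext v
      simp
  · intro B hBA hB
    by_contra! hno
    refine hA.2 B ⟨hBA.trans (erase_subset ..), fun h => ?_⟩ ?_
    · exact notMem_erase z A (hBA (h hz))
    · have heq : G.boundary X B = G.boundary (insert z X) B := by
        ext v
        rw [mem_boundary, mem_boundary, mem_insert, not_or]
        refine ⟨fun ⟨h1, h2, d, hd, hdv⟩ => ⟨⟨?_, h1⟩, h2, d, hd, hdv⟩,
          fun ⟨h1, h2, h3⟩ => ⟨h1.2, h2, h3⟩⟩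
        rintro rfl
        exact hno d hd hdv.symm
      obtain ⟨⟨hne, hBX, w, hwX, hwB, hwb⟩, hcard⟩ := hB
      rw [IsFragment, Separated, heq]
      exact ⟨⟨hne, hBX.mono_right (subset_insert ..), w,
        fun h => hwX (mem_insert_of_mem h), hwB, hwb⟩, hcard⟩

/-- In a triangle-free graph a vertex sees at most every other vertex of a walk. -/
lemma card_neighborFinset_inter_le_of_isChain (htf : G.CliqueFree 3) (v : V) :
    ∀ l : List V, l.IsChain G.Adj → 2 * #(G.neighborFinset v ∩ l.toFinset) ≤ l.length + 1
  | [], _ => by simp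
  | [a], _ => by
    have := card_le_card (inter_subset_right (s₁ := G.neighborFinset v) (s₂ := [a].toFinset))
    simp at this ⊢
    omega
  | a :: b :: l, h => by
    rw [List.isChain_cons_cons] at h
    have ih := card_neighborFinset_inter_le_of_isChain htf v l h.2.tail
    have hab : #(G.neighborFinset v ∩ {a, b}) ≤ 1 := by
      refine card_le_one.2 fun x hx y hy => ?_
      have hnot : G.Adj a v → ¬ G.Adj b v := fun hav hbv =>
        Finset.disjoint_left.1 (disjoint_neighborFinset_of_adj htf h.1)
          ((mem_neighborFinset ..).2 hav) ((mem_neighborFinset ..).2 hbv)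
      simp only [mem_inter, mem_neighborFinset, mem_insert, mem_singleton] at hx hy
      grind [G.adj_comm]
    have hsplit : G.neighborFinset v ∩ (a :: b :: l).toFinset =
        (G.neighborFinset v ∩ {a, b}) ∪ (G.neighborFinset v ∩ l.toFinset) := by
      ext x; simp; tauto
    have := card_union_le (G.neighborFinset v ∩ {a, b}) (G.neighborFinset v ∩ l.toFinset)
    rw [hsplit, List.length_cons, List.length_cons]
    omega

lemma Walk.lt_card_neighborFinset_sdiff_support (htf : G.CliqueFree 3) {m : ℕ}
    (hdeg : k + (m + 2) / 2 ≤ G.minDegree) {u v : V} (P : G.Walk u v)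
    (hP : P.support.length < m) (x : V) :
    k + 1 ≤ #(G.neighborFinset x \ P.support.toFinset) := by
  have h1 := card_neighborFinset_inter_le_of_isChain htf x P.support P.isChain_adj_support
  have h2 := G.minDegree_le_degree x
  rw [← card_neighborFinset_eq_degree] at h2
  have h3 := card_sdiff_add_card_inter (G.neighborFinset x) P.support.toFinset
  omega

/-- Paths of every order up to `m` can be removed keeping the separator bound. -/
theorem exists_path_separatorBound (htf : G.CliqueFree 3) {m : ℕ}
    (hdeg : k + (m + 2) / 2 ≤ G.minDegree) [Nonempty V] (hG : G.SeparatorBound k ∅)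
    (j : ℕ) (hj : j + 1 ≤ m) :
    ∃ (u v : V) (P : G.Walk u v) (F : Finset V), P.IsPath ∧ P.support.length = j + 1 ∧
      G.SeparatorBound k P.support.toFinset ∧ G.Extendable k P.support.toFinset F u ∧
      k + 1 ≤ #(P.support.toFinset)ᶜ := by
  induction j with
  | zero =>
    have hdeg' : ∀ v ∉ (∅ : Finset V), k + 1 ≤ #(G.neighborFinset v \ ∅) := by
      intro v _
      have := G.minDegree_le_degree v
      rw [sdiff_empty, card_neighborFinset_eq_degree]
      omega
    obtain ⟨A, hA, z, hz⟩ := exists_isAtomic_nonempty (G := G) (k := k) (X := ∅) (by simp)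
    have hE := hA.extendable_erase hdeg' hz
    have hS := hG.insert_of_mem_isAtomic htf hdeg' hA hz
    refine ⟨z, z, Walk.nil, A.erase z, by simp, by simp, by simpa using hS, by simpa using hE, ?_⟩
    refine (hdeg' z (by simp)).trans (card_le_card fun v hv => ?_)
    simp at hv ⊢
    exact hv.ne'
  | succ j ih =>
    obtain ⟨u, v, P, F, hP, hlen, hS, hF, -⟩ := ih (by omega)
    have hdeg' : ∀ v ∉ P.support.toFinset, k + 1 ≤ #(G.neighborFinset v \ P.support.toFinset) :=
      fun x _ => P.lt_card_neighborFinset_sdiff_support htf hdeg (by omega) x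
    obtain ⟨A, hA, z, hz, huz⟩ := hF.exists_isAtomic
    have hzP : z ∉ P.support.toFinset := Finset.disjoint_left.1 hA.disjoint hz
    refine ⟨z, v, Walk.cons huz.symm P, A.erase z, ?_, by simp [hlen], ?_, ?_, ?_⟩
    · rw [Walk.cons_isPath_iff]
      exact ⟨hP, by simpa using hzP⟩
    · simpa using hS.insert_of_mem_isAtomic htf hdeg' hA hz
    · simpa using hA.extendable_erase hdeg' hz
    · refine (hdeg' z hzP).trans (card_le_card fun x hx => ?_)
      simp at hx ⊢
      exact ⟨hx.1.ne', hx.2⟩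

/-- A `k`-connected graph has no separator of size below `k`. -/
lemma separatorBound_empty_of_kConnected (h : KConnected G k) : G.SeparatorBound k ∅ := by
  rintro B ⟨⟨b, hb⟩, -, w, -, hwB, hwb⟩
  by_contra! hlt
  have hconn := h.2 (G.boundary ∅ B : Finset V) (by rwa [Set.ncard_coe_finset])
  have hbb : b ∉ G.boundary ∅ B := fun h => (mem_boundary.1 h).2.1 hb
  obtain ⟨p⟩ := hconn.preconnected ⟨b, by simpa using hbb⟩ ⟨w, by simpa using hwb⟩
  obtain ⟨d, -, hd1, hd2⟩ := p.exists_boundary_dart {x | x.1 ∈ B} hb hwB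
  exact d.snd.2 (mem_boundary.2 ⟨by simp, hd2, d.fst.1, hd1, d.adj⟩)

/-- The separator bound gives connectivity of the graph `G - X`. -/
lemma SeparatorBound.kConnected_induce {s : Set V} (hs : ∀ v, v ∈ s ↔ v ∉ X)
    (h : G.SeparatorBound k X) (hcard : k + 1 ≤ #Xᶜ) : KConnected (G.induce s) k := by
  have hsX : s = ((Xᶜ : Finset V) : Set V) := by ext v; simp [hs]
  have hnc : Nat.card s = #Xᶜ := by
    rw [hsX, Nat.card_coe_set_eq, Set.ncard_coe_finset]
  refine ⟨by omega, fun S hS => ?_⟩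
  have hne : ∃ v, v ∉ S := by
    by_contra! hall
    have : S = Set.univ := Set.eq_univ_of_forall hall
    rw [this, Set.ncard_univ] at hS
    omega
  rw [connected_iff]
  refine ⟨fun a b => ?_, ?_⟩
  swap
  · obtain ⟨v, hv⟩ := hne
    exact ⟨⟨v, hv⟩⟩
  classical
  by_contra hab
  set D : Finset V := univ.filter fun v => ∃ (h1 : v ∈ s) (h2 : (⟨v, h1⟩ : s) ∉ S),
    ((G.induce s).induce Sᶜ).Reachable a ⟨⟨v, h1⟩, h2⟩ with hD
  have hDmem : ∀ v, v ∈ D ↔ ∃ (h1 : v ∈ s) (h2 : (⟨v, h1⟩ : s) ∉ S),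
    ((G.induce s).induce Sᶜ).Reachable a ⟨⟨v, h1⟩, h2⟩ := by
    intro v
    rw [hD, mem_filter]
    simp only [mem_univ, true_and]
  have hbS : (G.boundary X D : Set V) ⊆ Subtype.val '' S := by
    intro w hw
    obtain ⟨hwX, hwD, d, hd, hdw⟩ := mem_boundary.1 (mem_coe.1 hw)
    obtain ⟨h1, h2, hr⟩ := (hDmem d).1 hd
    refine ⟨⟨w, (hs w).2 hwX⟩, ?_, rfl⟩
    by_contra hwS
    refine hwD ((hDmem w).2 ⟨(hs w).2 hwX, hwS, hr.trans (Adj.reachable ?_)⟩)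
    simpa using hdw
  have hle : #(G.boundary X D) ≤ S.ncard := by
    rw [← Set.ncard_coe_finset, ← Set.ncard_image_of_injective S Subtype.val_injective]
    exact Set.ncard_le_ncard hbS (Set.toFinite _)
  have hk := h D ⟨⟨a.1.1, (hDmem _).2 ⟨a.1.2, a.2, Reachable.refl _⟩⟩, ?_, b.1.1, ?_, ?_, ?_⟩
  · omega
  · rw [Finset.disjoint_left]
    intro v hv
    exact (hs v).1 ((hDmem v).1 hv).1
  · exact (hs _).1 b.1.2
  · intro hb
    exact hab ((hDmem _).1 hb).2.2
  · intro hb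
    obtain ⟨x, hx, hxb⟩ := hbS (mem_coe.2 hb)
    exact b.2 (Subtype.val_injective hxb ▸ hx)

end SimpleGraph

theorem connectivity_keeping_path_triangle_free
    {V : Type} [Fintype V] (G : SimpleGraph V) [DecidableRel G.Adj]
    (k m : ℕ) (hk : 1 ≤ k) (hm : 1 ≤ m)
    (hGconn : KConnected G k) (htf : G.CliqueFree 3)
    -- `(m + 2) / 2 = ⌈(m + 1) / 2⌉` in natural-number arithmetic
    (hdeg : k + (m + 2) / 2 ≤ G.minDegree) :
    ∃ (u v : V) (P : G.Walk u v), P.IsPath ∧ P.support.length = m ∧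
      KConnected (G.induce {x | x ∈ P.support}ᶜ) k := by
  classical
  have hcard : 0 < Nat.card V := by have := hGconn.1; omega
  have : Nonempty V := (Nat.card_pos_iff.1 hcard).1
  obtain ⟨j, rfl⟩ : ∃ j, m = j + 1 := ⟨m - 1, by omega⟩
  obtain ⟨u, v, P, -, hP, hlen, hS, -, hc⟩ := SimpleGraph.exists_path_separatorBound htf hdeg
    (SimpleGraph.separatorBound_empty_of_kConnected hGconn) j le_rfl
  exact ⟨u, v, P, hP, hlen, hS.kConnected_induce (by simp) hc⟩
end
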